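/- arXiv:0907.3584 — 11 statements merged into one kernel-verified Lean document; each statement's English description precedes it below -/
import Mathlib

section
/- Let R(θ) = [[cos θ, −sin θ],[sin θ, cos θ]] be the 2×2 real rotation matrix, let ⊗ denote the Kronecker product, and let ψ = (1/√2)(e₀₀ − e₁₁) be the vector in ℝ^{2·2} indexed by Fin 2 × Fin 2. Define θ : Bool → ℝ by θ(false) = −π/16 and θ(true) = 3π/16. Then for all s, t ∈ Bool: (i) (R(θ₁) ⊗ R(θ₂))ψ = (1/√2)(cos(θ₁+θ₂)(e₀₀ − e₁₁) + sin(θ₁+θ₂)(e₀₁ + e₁₀)) for all θ₁, θ₂ ∈ ℝ; and (ii) the sum of the squares of the entries of (R(θ(s)) ⊗ R(θ(t)))ψ over indices (a,b) ∈ Fin 2 × Fin 2 with a ⊕ b equal to (s ∧ t) is exactly cos²(π/8). Hence the quantum CHSH protocol succeeds with probability cos²(π/8) on every input. -/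
open Matrix Kronecker

/-- The 2×2 real rotation matrix by angle `θ`. -/
noncomputable def rotM (θ : ℝ) : Matrix (Fin 2) (Fin 2) ℝ :=
  !![Real.cos θ, -Real.sin θ; Real.sin θ, Real.cos θ]

/-- Standard basis vector `e_{ab}` of `ℝ^{2·2}`. -/
def eCHSH (a b : Fin 2) : Fin 2 × Fin 2 → ℝ :=
  fun p => if p = (a, b) then 1 else 0

/-- The shared state `(1/√2)(|00⟩ − |11⟩)`. -/
noncomputable def psiCHSH : Fin 2 × Fin 2 → ℝ :=
  (Real.sqrt 2)⁻¹ • (eCHSH 0 0 - eCHSH 1 1)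

/-- Alice/Bob's measurement angles: `θ(false) = −π/16`, `θ(true) = 3π/16`. -/
noncomputable def thetaCHSH : Bool → ℝ :=
  fun s => if s then 3 * Real.pi / 16 else -(Real.pi / 16)

/-- The quantum CHSH protocol: (i) rotating the two halves of
`(1/√2)(|00⟩ − |11⟩)` by angles `θ₁, θ₂` yields
`(1/√2)(cos(θ₁+θ₂)(|00⟩ − |11⟩) + sin(θ₁+θ₂)(|01⟩ + |10⟩))`, and (ii) on every
input `(s,t)` the probability that the measured bits satisfy `a ⊕ b = s ∧ t`
is exactly `cos²(π/8)`. -/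
theorem chsh_quantum_strategy :
    (∀ θ₁ θ₂ : ℝ,
      (rotM θ₁ ⊗ₖ rotM θ₂).mulVec psiCHSH =
        (Real.sqrt 2)⁻¹ •
          (Real.cos (θ₁ + θ₂) • (eCHSH 0 0 - eCHSH 1 1) +
            Real.sin (θ₁ + θ₂) • (eCHSH 0 1 + eCHSH 1 0))) ∧
    (∀ s t : Bool,
      ∑ p ∈ Finset.univ.filter
          (fun p : Fin 2 × Fin 2 =>
            (p.1.val + p.2.val) % 2 = (if s && t then 1 else 0)),
        ((rotM (thetaCHSH s) ⊗ₖ rotM (thetaCHSH t)).mulVec psiCHSH p) ^ 2 =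
      Real.cos (Real.pi / 8) ^ 2) := by
  have key : ∀ θ₁ θ₂ : ℝ,
      (rotM θ₁ ⊗ₖ rotM θ₂).mulVec psiCHSH =
        (Real.sqrt 2)⁻¹ •
          (Real.cos (θ₁ + θ₂) • (eCHSH 0 0 - eCHSH 1 1) +
            Real.sin (θ₁ + θ₂) • (eCHSH 0 1 + eCHSH 1 0)) := by
    intro x y
    ext ⟨a, b⟩
    fin_cases a <;> fin_cases b <;>
      simp [Matrix.mulVec, dotProduct, Fintype.sum_prod_type, Fin.sum_univ_two, rotM,
        psiCHSH, eCHSH, Matrix.kroneckerMap_apply, Real.cos_add, Real.sin_add] <;> ring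
  refine ⟨key, ?_⟩
  have h2 : ((Real.sqrt 2)⁻¹) ^ 2 = 1 / 2 := by
    rw [inv_pow, Real.sq_sqrt (by norm_num)]; norm_num
  have e1 : Real.cos (-(Real.pi / 16) + -(Real.pi / 16)) = Real.cos (Real.pi / 8) := by
    rw [← Real.cos_neg]; congr 1; ring
  have e2 : Real.cos (-(Real.pi / 16) + 3 * Real.pi / 16) = Real.cos (Real.pi / 8) := by
    congr 1; ring
  have e3 : Real.cos (3 * Real.pi / 16 + -(Real.pi / 16)) = Real.cos (Real.pi / 8) := by
    congr 1; ring
  have e4 : Real.sin (3 * Real.pi / 16 + 3 * Real.pi / 16) = Real.cos (Real.pi / 8) := by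
    rw [← Real.sin_pi_div_two_sub]; congr 1; ring
  intro s t
  rw [key, Finset.sum_filter]
  cases s <;> cases t <;>
    simp only [Fintype.sum_prod_type, Fin.sum_univ_two, thetaCHSH, eCHSH, Pi.smul_apply,
      Pi.add_apply, Pi.sub_apply, smul_eq_mul] <;>
    simp [mul_pow, e1, e2, e3, e4, -inv_pow, h2] <;> ring
end

section
/- Tsirelson's bound for CHSH: Let A₀, A₁ be dA×dA Hermitian complex matrices whose squares are the identity, let B₀, B₁ be dB×dB Hermitian complex matrices whose squares are the identity, let ⊗ denote the Kronecker product, and let ψ be a unit vector in ℂ^{dA·dB} (indexed by Fin dA × Fin dB). Then the real part of ⟨ψ, (¼(A₀⊗B₀) + ¼(A₀⊗B₁) + ¼(A₁⊗B₀) − ¼(A₁⊗B₁))·ψ⟩ is at most 1/√2. Consequently, the expected value of (−1)^{s∧t}·a'·b' in any quantum CHSH strategy is at most 1/√2, and the success probability of any quantum protocol for the CHSH game under uniform inputs is at most (1+1/√2)/2 = cos²(π/8). -/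
open Matrix Kronecker

lemma chsh_re_symm {n : Type*} [Fintype n] (x y : n → ℂ) :
    (star x ⬝ᵥ y).re = (star y ⬝ᵥ x).re := by
  simp only [dotProduct, Complex.re_sum]
  refine Finset.sum_congr rfl fun i _ => ?_
  simp [Complex.mul_re]
  ring

lemma chsh_re_nonneg {n : Type*} [Fintype n] (x : n → ℂ) :
    0 ≤ (star x ⬝ᵥ x).re := by
  simp only [dotProduct, Complex.re_sum]
  refine Finset.sum_nonneg fun i _ => ?_
  simp [Complex.mul_re]
  nlinarith [mul_self_nonneg (x i).re, mul_self_nonneg (x i).im]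

lemma chsh_expand {n : Type*} [Fintype n] (x y z : n → ℂ) (s c : ℝ) :
    (star (x + (s : ℂ) • y - (c : ℂ) • z) ⬝ᵥ (x + (s : ℂ) • y - (c : ℂ) • z)).re
      = (star x ⬝ᵥ x).re + s ^ 2 * (star y ⬝ᵥ y).re + c ^ 2 * (star z ⬝ᵥ z).re
        + 2 * s * (star x ⬝ᵥ y).re - 2 * c * (star z ⬝ᵥ x).re
        - 2 * s * c * (star z ⬝ᵥ y).re := by
  have h1 := chsh_re_symm y x
  have h2 := chsh_re_symm x z
  have h3 := chsh_re_symm y z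
  simp only [star_add, star_sub, star_smul, dotProduct_add, add_dotProduct, dotProduct_sub,
    sub_dotProduct, smul_dotProduct, dotProduct_smul, Complex.add_re, Complex.sub_re,
    smul_eq_mul, Complex.star_def, Complex.conj_ofReal, Complex.re_ofReal_mul, h1, h2, h3]
  ring

lemma chsh_inner {n : Type*} [Fintype n] (P Q : Matrix n n ℂ) (hP : P.IsHermitian)
    (ψ : n → ℂ) : star (P *ᵥ ψ) ⬝ᵥ (Q *ᵥ ψ) = star ψ ⬝ᵥ ((P * Q) *ᵥ ψ) := by
  rw [star_mulVec, hP.eq, ← dotProduct_mulVec, mulVec_mulVec]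


/-- Tsirelson's bound for CHSH: for any ±1-valued observables `A₀, A₁` on
Alice's side, `B₀, B₁` on Bob's side, and any shared unit state `ψ`, the
CHSH expectation `⟨ψ, (¼ A₀⊗B₀ + ¼ A₀⊗B₁ + ¼ A₁⊗B₀ − ¼ A₁⊗B₁) ψ⟩` has real
part at most `1/√2`. -/
theorem tsirelson_chsh_bound {dA dB : ℕ}
    (A₀ A₁ : Matrix (Fin dA) (Fin dA) ℂ)
    (hA₀ : A₀.IsHermitian) (hA₁ : A₁.IsHermitian)
    (hA₀sq : A₀ * A₀ = 1) (hA₁sq : A₁ * A₁ = 1)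
    (B₀ B₁ : Matrix (Fin dB) (Fin dB) ℂ)
    (hB₀ : B₀.IsHermitian) (hB₁ : B₁.IsHermitian)
    (hB₀sq : B₀ * B₀ = 1) (hB₁sq : B₁ * B₁ = 1)
    (ψ : Fin dA × Fin dB → ℂ) (hψ : star ψ ⬝ᵥ ψ = 1) :
    (star ψ ⬝ᵥ
        (((1 / 4 : ℂ) • (A₀ ⊗ₖ B₀) + (1 / 4 : ℂ) • (A₀ ⊗ₖ B₁) +
          (1 / 4 : ℂ) • (A₁ ⊗ₖ B₀) - (1 / 4 : ℂ) • (A₁ ⊗ₖ B₁)).mulVec ψ)).re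
      ≤ 1 / Real.sqrt 2 := by
  have hA : ∀ A : Matrix (Fin dA) (Fin dA) ℂ, A.IsHermitian →
      (A ⊗ₖ (1 : Matrix (Fin dB) (Fin dB) ℂ)).IsHermitian := by
    intro A h
    rw [IsHermitian, conjTranspose_kronecker, h.eq, conjTranspose_one]
  have hB : ∀ B : Matrix (Fin dB) (Fin dB) ℂ, B.IsHermitian →
      ((1 : Matrix (Fin dA) (Fin dA) ℂ) ⊗ₖ B).IsHermitian := by
    intro A h
    rw [IsHermitian, conjTranspose_kronecker, h.eq, conjTranspose_one]
  have nA : ∀ A : Matrix (Fin dA) (Fin dA) ℂ, A.IsHermitian → A * A = 1 →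
      star ((A ⊗ₖ (1 : Matrix (Fin dB) (Fin dB) ℂ)) *ᵥ ψ) ⬝ᵥ
        ((A ⊗ₖ (1 : Matrix (Fin dB) (Fin dB) ℂ)) *ᵥ ψ) = 1 := by
    intro A h h2
    rw [chsh_inner _ _ (hA A h), ← mul_kronecker_mul, h2, one_mul, one_kronecker_one,
      one_mulVec, hψ]
  have nB : ∀ B : Matrix (Fin dB) (Fin dB) ℂ, B.IsHermitian → B * B = 1 →
      star (((1 : Matrix (Fin dA) (Fin dA) ℂ) ⊗ₖ B) *ᵥ ψ) ⬝ᵥ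
        (((1 : Matrix (Fin dA) (Fin dA) ℂ) ⊗ₖ B) *ᵥ ψ) = 1 := by
    intro A h h2
    rw [chsh_inner _ _ (hB A h), ← mul_kronecker_mul, h2, one_mul, one_kronecker_one,
      one_mulVec, hψ]
  have cr : ∀ (A : Matrix (Fin dA) (Fin dA) ℂ) (B : Matrix (Fin dB) (Fin dB) ℂ),
      A.IsHermitian → star ((A ⊗ₖ (1 : Matrix (Fin dB) (Fin dB) ℂ)) *ᵥ ψ) ⬝ᵥ
        (((1 : Matrix (Fin dA) (Fin dA) ℂ) ⊗ₖ B) *ᵥ ψ) = star ψ ⬝ᵥ ((A ⊗ₖ B) *ᵥ ψ) := by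
    intro A B h
    rw [chsh_inner _ _ (hA A h), ← mul_kronecker_mul, mul_one, one_mul]
  have e1 := chsh_re_nonneg ((1 ⊗ₖ B₀) *ᵥ ψ + ((1 : ℝ) : ℂ) • ((1 ⊗ₖ B₁) *ᵥ ψ)
    - ((Real.sqrt 2 : ℝ) : ℂ) • ((A₀ ⊗ₖ 1) *ᵥ ψ))
  have e2 := chsh_re_nonneg ((1 ⊗ₖ B₀) *ᵥ ψ + ((-1 : ℝ) : ℂ) • ((1 ⊗ₖ B₁) *ᵥ ψ)
    - ((Real.sqrt 2 : ℝ) : ℂ) • ((A₁ ⊗ₖ 1) *ᵥ ψ))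
  rw [chsh_expand, nA _ hA₀ hA₀sq, nB _ hB₀ hB₀sq, nB _ hB₁ hB₁sq, cr _ _ hA₀, cr _ _ hA₀] at e1
  rw [chsh_expand, nA _ hA₁ hA₁sq, nB _ hB₀ hB₀sq, nB _ hB₁ hB₁sq, cr _ _ hA₁, cr _ _ hA₁] at e2
  have h4 : (1 / 4 : ℂ) = ((1 / 4 : ℝ) : ℂ) := by norm_num
  have hs : Real.sqrt 2 ^ 2 = 2 := Real.sq_sqrt (by norm_num)
  have hp : 0 < Real.sqrt 2 := by positivity
  rw [h4]
  simp only [add_mulVec, sub_mulVec, smul_mulVec, dotProduct_add, dotProduct_sub,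
    dotProduct_smul, Complex.add_re, Complex.sub_re, smul_eq_mul, Complex.re_ofReal_mul]
  rw [le_div_iff₀ hp]
  simp only [Complex.one_re, hs] at e1 e2
  linarith
end

section
/- Let A₀, A₁ be dA×dA Hermitian complex matrices whose squares are the identity, let B₀, B₁ be dB×dB Hermitian complex matrices whose squares are the identity, let ⊗ denote the Kronecker product, and set C = A₀⊗B₀ + A₀⊗B₁ + A₁⊗B₀ − A₁⊗B₁. Then the matrix 8·I − C² is positive semidefinite, where I is the (dA·dB)×(dA·dB) identity; equivalently, every eigenvalue of C has absolute value at most 2√2. -/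
open Matrix Kronecker ComplexOrder

/-- The key operator inequality in the proof of Tsirelson's bound: for
±1-valued observables `A₀, A₁` and `B₀, B₁`, the CHSH operator
`C = A₀⊗B₀ + A₀⊗B₁ + A₁⊗B₀ − A₁⊗B₁` satisfies `8·I − C² ⪰ 0`, i.e. every
eigenvalue of `C` has absolute value at most `2√2`. -/
theorem chsh_operator_bound {dA dB : ℕ}
    (A₀ A₁ : Matrix (Fin dA) (Fin dA) ℂ)
    (hA₀ : A₀.IsHermitian) (hA₁ : A₁.IsHermitian)
    (hA₀sq : A₀ * A₀ = 1) (hA₁sq : A₁ * A₁ = 1)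
    (B₀ B₁ : Matrix (Fin dB) (Fin dB) ℂ)
    (hB₀ : B₀.IsHermitian) (hB₁ : B₁.IsHermitian)
    (hB₀sq : B₀ * B₀ = 1) (hB₁sq : B₁ * B₁ = 1) :
    ((8 : ℂ) • (1 : Matrix (Fin dA × Fin dB) (Fin dA × Fin dB) ℂ) -
        (A₀ ⊗ₖ B₀ + A₀ ⊗ₖ B₁ + A₁ ⊗ₖ B₀ - A₁ ⊗ₖ B₁) *
          (A₀ ⊗ₖ B₀ + A₀ ⊗ₖ B₁ + A₁ ⊗ₖ B₀ - A₁ ⊗ₖ B₁)).PosSemidef := by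
  have hP : A₁ * A₀ * (A₀ * A₁) = 1 := by
    rw [Matrix.mul_assoc, ← Matrix.mul_assoc A₀, hA₀sq, Matrix.one_mul, hA₁sq]
  have hQ : B₁ * B₀ * (B₀ * B₁) = 1 := by
    rw [Matrix.mul_assoc, ← Matrix.mul_assoc B₀, hB₀sq, Matrix.one_mul, hB₁sq]
  have hQ' : B₀ * B₁ * (B₁ * B₀) = 1 := by
    rw [Matrix.mul_assoc, ← Matrix.mul_assoc B₁, hB₁sq, Matrix.one_mul, hB₀sq]
  have h1 := Matrix.posSemidef_conjTranspose_mul_self (1 + (A₀ * A₁) ⊗ₖ (B₀ * B₁))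
  have h2 := Matrix.posSemidef_conjTranspose_mul_self (1 - (A₀ * A₁) ⊗ₖ (B₁ * B₀))
  have h := h1.add h2
  have h8 : (8 : ℂ) • (1 : Matrix (Fin dA × Fin dB) (Fin dA × Fin dB) ℂ) = (8 : ℤ) • 1 := by
    rw [← Int.cast_smul_eq_zsmul ℂ]; norm_num
  rw [h8]
  convert h using 1
  simp only [conjTranspose_add, conjTranspose_sub, conjTranspose_one, conjTranspose_kronecker,
    conjTranspose_mul, hA₀.eq, hA₁.eq, hB₀.eq, hB₁.eq, mul_add, add_mul, mul_sub, sub_mul,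
    ← mul_kronecker_mul, hA₀sq, hA₁sq, hB₀sq, hB₁sq, hP, hQ, hQ', one_kronecker_one,
    Matrix.one_mul, Matrix.mul_one]
  abel
end

section
/- For all functions a : Fin 3 → Fin 3 → ℤ/2ℤ and b : Fin 3 → Fin 3 → ℤ/2ℤ, the number of pairs (s,t) ∈ Fin 3 × Fin 3 satisfying all three conditions ∑_{j} a s j = 0, ∑_{i} b t i = 1, and a s t = b t s, is at most 8. That is, every deterministic classical strategy for the magic square game wins on at most 8 of the 9 input pairs, so the classical success probability under uniform inputs is at most 8/9. -/
open Finset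

/-- Every deterministic classical strategy for the magic square game wins on
at most 8 of the 9 input pairs, so its success probability under uniform
inputs is at most 8/9. -/
theorem magic_square_classical_bound (a b : Fin 3 → Fin 3 → ZMod 2) :
    (Finset.univ.filter (fun st : Fin 3 × Fin 3 =>
        (∑ j, a st.1 j = 0) ∧ (∑ i, b st.2 i = 1) ∧ a st.1 st.2 = b st.2 st.1)).card
      ≤ 8 := by
  by_contra hlt
  have hle := Finset.card_le_univ (Finset.univ.filter (fun st : Fin 3 × Fin 3 =>
        (∑ j, a st.1 j = 0) ∧ (∑ i, b st.2 i = 1) ∧ a st.1 st.2 = b st.2 st.1))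
  have hc : Fintype.card (Fin 3 × Fin 3) = 9 := by simp
  have huniv := (Finset.card_eq_iff_eq_univ _).1 (le_antisymm hle (by omega))
  have h : ∀ s t : Fin 3, (∑ j, a s j = 0) ∧ (∑ i, b t i = 1) ∧ a s t = b t s := by
    intro s t
    have hm := Finset.mem_univ (s, t)
    rw [← huniv] at hm
    exact (Finset.mem_filter.1 hm).2
  -- summing all entries by rows gives 0, by columns gives 3 = 1
  have h0 : ∑ s, ∑ t, a s t = 0 := Finset.sum_eq_zero fun s _ => (h s 0).1
  have h1 : ∑ s, ∑ t, a s t = ∑ t : Fin 3, (1 : ZMod 2) := by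
    rw [Finset.sum_comm]
    refine Finset.sum_congr rfl fun t _ => ?_
    rw [← (h 0 t).2.1]
    exact Finset.sum_congr rfl fun s _ => (h s t).2.2
  rw [h0] at h1
  revert h1
  decide
end

section
/- Let I, X, Y, Z be the 2×2 Pauli matrices I = [[1,0],[0,1]], X = [[0,1],[1,0]], Y = [[0,−i],[i,0]], Z = [[1,0],[0,−1]] over ℂ, let ⊗ denote the Kronecker product, and let T : Fin 3 → Fin 3 → Matrix (Fin 4) (Fin 4) ℂ be the table with rows (X⊗X, Y⊗Z, Z⊗Y), (Y⊗Y, Z⊗X, X⊗Z), (Z⊗Z, X⊗Y, Y⊗X). Then: (i) for every row i, the three matrices T i 0, T i 1, T i 2 pairwise commute and their product equals the 4×4 identity I⊗I; and (ii) for every column j, the three matrices T 0 j, T 1 j, T 2 j pairwise commute and their product equals −(I⊗I). -/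
open Matrix Kronecker

/-- The Pauli matrix X. -/
def pauliX : Matrix (Fin 2) (Fin 2) ℂ := !![0, 1; 1, 0]

/-- The Pauli matrix Y. -/
def pauliY : Matrix (Fin 2) (Fin 2) ℂ := !![0, -Complex.I; Complex.I, 0]

/-- The Pauli matrix Z. -/
def pauliZ : Matrix (Fin 2) (Fin 2) ℂ := !![1, 0; 0, -1]

/-- Mermin's magic-square table of two-qubit observables. -/
def merminTable : Fin 3 → Fin 3 → Matrix (Fin 2 × Fin 2) (Fin 2 × Fin 2) ℂ :=
  ![![pauliX ⊗ₖ pauliX, pauliY ⊗ₖ pauliZ, pauliZ ⊗ₖ pauliY],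
    ![pauliY ⊗ₖ pauliY, pauliZ ⊗ₖ pauliX, pauliX ⊗ₖ pauliZ],
    ![pauliZ ⊗ₖ pauliZ, pauliX ⊗ₖ pauliY, pauliY ⊗ₖ pauliX]]

lemma pXX : pauliX * pauliX = 1 := by
  ext i j; fin_cases i <;> fin_cases j <;> simp [pauliX]
lemma pYY : pauliY * pauliY = 1 := by
  ext i j; fin_cases i <;> fin_cases j <;> simp [pauliY]
lemma pZZ : pauliZ * pauliZ = 1 := by
  ext i j; fin_cases i <;> fin_cases j <;> simp [pauliZ]
lemma pXY : pauliX * pauliY = Complex.I • pauliZ := by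
  ext i j; fin_cases i <;> fin_cases j <;> simp [pauliX, pauliY, pauliZ]
lemma pYX : pauliY * pauliX = -(Complex.I • pauliZ) := by
  ext i j; fin_cases i <;> fin_cases j <;> simp [pauliX, pauliY, pauliZ]
lemma pYZ : pauliY * pauliZ = Complex.I • pauliX := by
  ext i j; fin_cases i <;> fin_cases j <;> simp [pauliX, pauliY, pauliZ]
lemma pZY : pauliZ * pauliY = -(Complex.I • pauliX) := by
  ext i j; fin_cases i <;> fin_cases j <;> simp [pauliX, pauliY, pauliZ]
lemma pZX : pauliZ * pauliX = Complex.I • pauliY := by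
  ext i j; fin_cases i <;> fin_cases j <;> simp [pauliX, pauliY, pauliZ]
lemma pXZ : pauliX * pauliZ = -(Complex.I • pauliY) := by
  ext i j; fin_cases i <;> fin_cases j <;> simp [pauliX, pauliY, pauliZ]

lemma neg_kron (A B : Matrix (Fin 2) (Fin 2) ℂ) : (-A) ⊗ₖ B = -(A ⊗ₖ B) := by
  ext; simp [kroneckerMap_apply]
lemma kron_neg (A B : Matrix (Fin 2) (Fin 2) ℂ) : A ⊗ₖ (-B) = -(A ⊗ₖ B) := by
  ext; simp [kroneckerMap_apply]

/-- In Mermin's table: along each row the three observables pairwise commute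
and their product is the identity `I ⊗ I`; along each column they pairwise
commute and their product is `−(I ⊗ I)`. -/
theorem mermin_table_row_col :
    (∀ i : Fin 3,
      (∀ j j' : Fin 3, merminTable i j * merminTable i j' = merminTable i j' * merminTable i j) ∧
      merminTable i 0 * merminTable i 1 * merminTable i 2 = 1) ∧
    (∀ j : Fin 3,
      (∀ i i' : Fin 3, merminTable i j * merminTable i' j = merminTable i' j * merminTable i j) ∧
      merminTable 0 j * merminTable 1 j * merminTable 2 j = -1) := by
  refine ⟨fun i => ⟨fun j j' => ?_, ?_⟩, fun j => ⟨fun i i' => ?_, ?_⟩⟩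
  · fin_cases i <;> fin_cases j <;> fin_cases j' <;>
      simp [merminTable, ← mul_kronecker_mul, pXX, pYY, pZZ, pXY, pYX, pYZ, pZY, pZX, pXZ, neg_kron, kron_neg, smul_kronecker, kronecker_smul, smul_smul]
  · fin_cases i <;>
      simp [merminTable, ← mul_kronecker_mul, pXX, pYY, pZZ, pXY, pYX, pYZ, pZY, pZX, pXZ, neg_kron, kron_neg, smul_kronecker, kronecker_smul, smul_smul]
  · fin_cases j <;> fin_cases i <;> fin_cases i' <;>
      simp [merminTable, ← mul_kronecker_mul, pXX, pYY, pZZ, pXY, pYX, pYZ, pZY, pZX, pXZ, neg_kron, kron_neg, smul_kronecker, kronecker_smul, smul_smul]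
  · fin_cases j <;>
      simp [merminTable, ← mul_kronecker_mul, pXX, pYY, pZZ, pXY, pYX, pYZ, pZY, pZX, pXZ, neg_kron, kron_neg, smul_kronecker, kronecker_smul, smul_smul]
end

section
/- Correctness of the non-local Deutsch-Jozsa protocol: Let m ≥ 1, let n = 2^m, and index qubit basis states by I = (Fin m → ℤ/2ℤ) with inner product i·j = ∑_k i_k j_k ∈ ℤ/2ℤ. For x, y : I → ℤ/2ℤ define, for a, b ∈ I, the amplitude amp(a,b) = n^{−3/2} · ∑_{i ∈ I} (−1)^{x(i) + y(i) + i·(a+b)} (where (−1)^z for z ∈ ℤ/2ℤ means (−1)^{z.val} ∈ ℝ). Then ∑_{a ∈ I} amp(a,a)² = 1 if x = y, and ∑_{a ∈ I} amp(a,a)² = 0 if x and y differ at exactly n/2 points of I. That is, under the Deutsch-Jozsa promise, Alice and Bob's measurement outcomes on log n shared ebits are equal with certainty when x = y and are never equal when x and y differ in exactly n/2 positions. -/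
open Finset

/-- The joint amplitude `amp(a,b)` of outcomes `(a,b)` in the non-local
Deutsch-Jozsa protocol on `m` shared ebits:
`amp(a,b) = n^{−3/2} · ∑_i (−1)^{x(i) + y(i) + i·(a+b)}` where `n = 2^m`. -/
noncomputable def djAmp (m : ℕ) (x y : (Fin m → ZMod 2) → ZMod 2)
    (a b : Fin m → ZMod 2) : ℝ :=
  ((2 ^ m : ℝ) * Real.sqrt (2 ^ m))⁻¹ *
    ∑ i : Fin m → ZMod 2, (-1 : ℝ) ^ (x i + y i + ∑ k, i k * (a k + b k)).val

theorem djAmp_diag (m : ℕ) (x y : (Fin m → ZMod 2) → ZMod 2) (a : Fin m → ZMod 2) :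
    djAmp m x y a a = ((2 ^ m : ℝ) * Real.sqrt (2 ^ m))⁻¹ *
      (2 ^ m - 2 * ((Finset.univ.filter (fun i : Fin m → ZMod 2 => x i ≠ y i)).card : ℝ)) := by
  have key : ∀ u v : ZMod 2, (-1 : ℝ) ^ (u + v).val = 1 - 2 * (if u ≠ v then 1 else 0) := by
    intro u v
    have h : (u + v).val = if u ≠ v then 1 else 0 := by
      revert u v; decide
    rw [h]
    split_ifs <;> norm_num
  have h2 : ∀ u : ZMod 2, u + u = 0 := by decide
  unfold djAmp
  congr 1
  simp only [h2, mul_zero, Finset.sum_const_zero, add_zero, key]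
  rw [Finset.sum_sub_distrib, ← Finset.mul_sum, Finset.sum_boole]
  simp

/-- Correctness of the non-local Deutsch-Jozsa protocol: under the DJ promise,
the probability that Alice and Bob obtain equal outcomes is 1 when `x = y` and
0 when `x` and `y` differ in exactly `n/2` positions (`n = 2^m`). -/
theorem nonlocal_deutsch_jozsa (m : ℕ) (hm : 1 ≤ m)
    (x y : (Fin m → ZMod 2) → ZMod 2) :
    (x = y → ∑ a : Fin m → ZMod 2, djAmp m x y a a ^ 2 = 1) ∧
    ((Finset.univ.filter (fun i : Fin m → ZMod 2 => x i ≠ y i)).card = 2 ^ m / 2 →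
      ∑ a : Fin m → ZMod 2, djAmp m x y a a ^ 2 = 0) := by
  refine ⟨fun h => ?_, fun h => ?_⟩
  · subst h
    have hs : Real.sqrt (2 ^ m) ^ 2 = (2 : ℝ) ^ m := Real.sq_sqrt (by positivity)
    have hp : (2 : ℝ) ^ m ≠ 0 := by positivity
    simp only [djAmp_diag, Finset.sum_const]
    simp [hs]
  · have h2 : 2 * (2 ^ m / 2) = 2 ^ m := Nat.mul_div_cancel' (dvd_pow_self 2 (by omega))
    have h3 : (2 : ℝ) * ((2 ^ m / 2 : ℕ) : ℝ) = 2 ^ m := by exact_mod_cast h2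
    simp only [djAmp_diag, h, h3]
    simp
end

section
/- Classical lower bound for the Distributed Deutsch-Jozsa problem (rectangle form): Let n be a positive integer divisible by 4, and let W be the set of x : Fin n → Bool of Hamming weight n/2. Suppose 𝓡 is a finite family of rectangles, i.e., sets of the form A × B with A, B ⊆ (Fin n → Bool), such that (i) every pair (x,x) with x ∈ W lies in some rectangle of 𝓡, and (ii) no rectangle of 𝓡 contains both a pair (x,x) with x ∈ W and a pair (y,z) with y, z ∈ W at Hamming distance exactly n/2. Then |𝓡| · 1.99^n ≥ (n choose n/2). Consequently every deterministic classical protocol for the Distributed Deutsch-Jozsa problem communicates at least log₂((n choose n/2)/1.99^n) bits. -/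
open Finset

/-- The set of `n`-bit strings of Hamming weight `n/2`. -/
def halfWeight (n : ℕ) : Set (Fin n → Bool) :=
  {x | (Finset.univ.filter (fun i => x i = true)).card = n / 2}

/-- Hamming weight. -/
def djWt {n : ℕ} (x : Fin n → Bool) : ℤ := ∑ i, if x i = true then 1 else 0

/-- Size of the intersection of the supports. -/
def djInt {n : ℕ} (x y : Fin n → Bool) : ℤ :=
  ∑ i, if (x i = true ∧ y i = true) then 1 else 0

/-- Hamming distance. -/
def djDist {n : ℕ} (x y : Fin n → Bool) : ℤ := ∑ i, if x i ≠ y i then 1 else 0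

/-- Prepending a bit. -/
def djCons {n : ℕ} (c : Bool) (x : Fin n → Bool) : Fin (n + 1) → Bool := Fin.cons c x

/-- The fiber of a family over the first bit. -/
def djFib {n : ℕ} (F : Finset (Fin (n + 1) → Bool)) (c : Bool) : Finset (Fin n → Bool) :=
  Finset.univ.filter (fun x => djCons c x ∈ F)

lemma mem_djFib {n : ℕ} (F : Finset (Fin (n + 1) → Bool)) (c : Bool) (x : Fin n → Bool) :
    x ∈ djFib F c ↔ djCons c x ∈ F := by simp [djFib]

lemma djCons_inj {n : ℕ} (c : Bool) : Function.Injective (djCons (n := n) c) := by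
  intro x y h
  exact Fin.cons_right_injective (α := fun _ => Bool) c h

lemma card_djFib {n : ℕ} (F : Finset (Fin (n + 1) → Bool)) :
    F.card = (djFib F false).card + (djFib F true).card := by
  have hF : F = (djFib F false).image (djCons false) ∪ (djFib F true).image (djCons true) := by
    ext x
    simp only [Finset.mem_union, Finset.mem_image, mem_djFib]
    constructor
    · intro hx
      have hx' : djCons (x 0) (Fin.tail x) = x := Fin.cons_self_tail x
      cases h0 : x 0
      · left; rw [h0] at hx'; exact ⟨Fin.tail x, by rwa [hx'], hx'⟩
      · right; rw [h0] at hx'; exact ⟨Fin.tail x, by rwa [hx'], hx'⟩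
    · rintro (⟨y, hy, rfl⟩ | ⟨y, hy, rfl⟩) <;> exact hy
  have hd : Disjoint ((djFib F false).image (djCons false)) ((djFib F true).image (djCons true)) := by
    rw [Finset.disjoint_left]
    intro x hx hy
    simp only [Finset.mem_image] at hx hy
    obtain ⟨u, _, rfl⟩ := hx
    obtain ⟨v, _, hv⟩ := hy
    have := congrFun hv 0
    simp [djCons] at this
  conv_lhs => rw [hF]
  rw [Finset.card_union_of_disjoint hd, Finset.card_image_of_injective _ (djCons_inj _),
    Finset.card_image_of_injective _ (djCons_inj _)]

lemma djWt_cons {n : ℕ} (c : Bool) (x : Fin n → Bool) :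
    djWt (djCons c x) = (if c = true then 1 else 0) + djWt x := by
  simp [djWt, djCons, Fin.sum_univ_succ]

lemma djInt_cons {n : ℕ} (c e : Bool) (x y : Fin n → Bool) :
    djInt (djCons c x) (djCons e y) = (if (c = true ∧ e = true) then 1 else 0) + djInt x y := by
  simp [djInt, djCons, Fin.sum_univ_succ]

lemma djDist_cons {n : ℕ} (c e : Bool) (x y : Fin n → Bool) :
    djDist (djCons c x) (djCons e y) = (if c ≠ e then 1 else 0) + djDist x y := by
  simp [djDist, djCons, Fin.sum_univ_succ]

lemma djDist_eq {n : ℕ} (x y : Fin n → Bool) :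
    djDist x y = djWt x + djWt y - 2 * djInt x y := by
  unfold djDist djWt djInt
  rw [Finset.mul_sum, ← Finset.sum_add_distrib, ← Finset.sum_sub_distrib]
  refine Finset.sum_congr rfl fun i _ => ?_
  cases x i <;> cases y i <;> simp

lemma djWt_nonneg {n : ℕ} (x : Fin n → Bool) : 0 ≤ djWt x :=
  Finset.sum_nonneg fun i _ => by split_ifs <;> simp

lemma djWt_le {n : ℕ} (x : Fin n → Bool) : djWt x ≤ n := by
  have : djWt x ≤ ∑ i : Fin n, (1 : ℤ) := Finset.sum_le_sum fun i _ => by split_ifs <;> simp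
  simpa using this

lemma card_le_two_pow {n : ℕ} (F : Finset (Fin n → Bool)) : (F.card : ℝ) ≤ 2 ^ n := by
  have h := Finset.card_le_univ F
  simp at h
  exact_mod_cast h

lemma prod_card_le {n : ℕ} (F G : Finset (Fin n → Bool)) :
    (F.card : ℝ) * G.card ≤ 4 ^ n := by
  have h1 := card_le_two_pow F
  have h2 := card_le_two_pow G
  calc (F.card : ℝ) * G.card ≤ 2 ^ n * 2 ^ n := by gcongr
    _ = 4 ^ n := by rw [← mul_pow]; norm_num

/-- Numeric step of the distance induction. -/
lemma dist_step (p q r s X Y U : ℝ) (hq : 0 ≤ q) (hs : 0 ≤ s) (hqp : q ≤ p) (hsr : s ≤ r)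
    (hX : 0 < X) (hY : 0 ≤ Y)
    (h1 : p * r ≤ X) (h2 : q * r ≤ Y) (h3 : p * s ≤ Y) (hU : (X + Y) ^ 2 ≤ X * U) :
    (p + q) * (r + s) ≤ U := by
  have hp : 0 ≤ p := hq.trans hqp
  have hr : 0 ≤ r := hs.trans hsr
  have key : (p + q) * (r + s) * X ≤ (X + Y) ^ 2 := by
    rcases hp.eq_or_lt with hp0 | hp0
    · have : q = 0 := by linarith
      subst this; subst hp0; simp; positivity
    rcases hr.eq_or_lt with hr0 | hr0
    · have : s = 0 := by linarith
      subst this; subst hr0; simp; positivity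
    have hz : 0 < p * r := by positivity
    rcases le_total Y (p * r) with hYz | hYz
    · -- `(p+q)(r+s) z ≤ (z+Y)^2`
      have e1 : (p + q) * (r + s) * (p * r) = (p * r + q * r) * (p * r + p * s) := by ring
      have e2 : (p * r + q * r) * (p * r + p * s) ≤ (p * r + Y) * (p * r + Y) := by
        apply mul_le_mul <;> first | linarith | positivity
      have e3 : (p * r + Y) ^ 2 * X ≤ (X + Y) ^ 2 * (p * r) := by
        have : 0 ≤ (X - p * r) * (X * (p * r) - Y ^ 2) := by
          apply mul_nonneg (by linarith)
          nlinarith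
        nlinarith
      have e4 : (p + q) * (r + s) * X * (p * r) ≤ (X + Y) ^ 2 * (p * r) := by
        calc (p + q) * (r + s) * X * (p * r) = ((p + q) * (r + s) * (p * r)) * X := by ring
          _ ≤ ((p * r + Y) * (p * r + Y)) * X := by rw [e1]; gcongr
          _ = (p * r + Y) ^ 2 * X := by ring
          _ ≤ _ := e3
      exact le_of_mul_le_mul_right e4 hz
    · have e1 : (p + q) * (r + s) ≤ (p + p) * (r + r) := by gcongr
      have e2 : (p + q) * (r + s) ≤ 4 * Y := by nlinarith
      calc (p + q) * (r + s) * X ≤ 4 * Y * X := by gcongr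
        _ ≤ (X + Y) ^ 2 := by nlinarith [sq_nonneg (X - Y)]
  have : (p + q) * (r + s) * X ≤ U * X := by linarith
  exact le_of_mul_le_mul_right this hX

/-- Numeric step of the intersection induction. -/
lemma int_step (p f0 f1 u v g g0 g1 u' v' M : ℝ) (hp : p = f0 + f1) (hp' : p = u + v)
    (hg : g = g0 + g1) (hg' : g = u' + v')
    (h0 : 0 ≤ f0) (h1 : 0 ≤ f1) (hv : 0 ≤ v) (hvu : v ≤ u)
    (k0 : 0 ≤ g0) (k1 : 0 ≤ g1) (kv : 0 ≤ v') (kvu : v' ≤ u')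
    (A : u * g0 ≤ 0.3 * M) (B : v * g1 ≤ 0.15 * M) (A' : f0 * u' ≤ 0.3 * M)
    (B' : f1 * v' ≤ 0.15 * M) (Z : f1 * g1 ≤ 0.3 * M) (hM : 0 ≤ M) : p * g ≤ M := by
  by_contra! hcon
  have main : ∀ p u v g0 g1 g : ℝ, p = u + v → g = g0 + g1 → 0 ≤ v → v ≤ u → 0 ≤ g0 → 0 ≤ g1 →
      u * g0 + v * g1 < 0.45 * (p * g) → 0.55 * g ≤ g1 := by
    intro p u v g0 g1 g hp hg hv hvu k0 k1 h
    by_contra! hc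
    subst hp hg
    rcases le_total g1 g0 with hh | hh
    · nlinarith [mul_nonneg (sub_nonneg.2 hvu) (sub_nonneg.2 hh)]
    · have : 0 ≤ v * (g1 - g0) := mul_nonneg hv (by linarith)
      have : 0 ≤ (u + v) * (g0 - 0.45 * (g0 + g1)) := mul_nonneg (by linarith) (by linarith)
      nlinarith
  have a1 := main p u v g0 g1 g hp' hg hv hvu k0 k1 (by linarith)
  have a2 := main g u' v' f0 f1 p hg' hp kv kvu h0 h1 (by linarith)
  have hp0 : 0 ≤ p := by linarith
  have hg0 : 0 ≤ g := by linarith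
  have : (0.55 * p) * (0.55 * g) ≤ f1 * g1 := mul_le_mul a2 a1 (by linarith) h1
  nlinarith

/-- The bound of the distance induction. -/
noncomputable def djU (n : ℕ) (a b : ℤ) : ℝ :=
  4 ^ n * 3 ^ (a - b - 1) + 3 ^ a * (16 / 9) ^ n + 3 ^ (-b) * (16 / 3) ^ n

/-- Families avoiding an interval of Hamming distances. -/
lemma dist_bound (n : ℕ) : ∀ (F G : Finset (Fin n → Bool)) (a b : ℤ), a ≤ b + 1 →
    (∀ x ∈ F, ∀ y ∈ G, djDist x y < a ∨ b < djDist x y) →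
    (F.card : ℝ) * G.card ≤ djU n a b := by
  induction n with
  | zero =>
    intro F G a b hab h
    have hle := prod_card_le F G
    unfold djU
    have p1 : (0 : ℝ) < 3 ^ (a - b - 1) := by positivity
    have p2 : (0 : ℝ) < 3 ^ a := by positivity
    have p3 : (0 : ℝ) < 3 ^ (-b) := by positivity
    rcases F.eq_empty_or_nonempty with rfl | ⟨x, hx⟩
    · simp; positivity
    rcases G.eq_empty_or_nonempty with rfl | ⟨y, hy⟩
    · simp; positivity
    have hd : djDist x y = 0 := by simp [djDist]
    rcases h x hx y hy with h | h
    · have : (1 : ℝ) ≤ 3 ^ a := one_le_zpow₀ (by norm_num) (by omega)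
      simp only [pow_zero] at *
      linarith
    · have : (1 : ℝ) ≤ 3 ^ (-b) := one_le_zpow₀ (by norm_num) (by omega)
      simp only [pow_zero] at *
      linarith
  | succ n ih =>
    intro F G a b hab h
    rcases hab.eq_or_lt with hab | hab
    · have hle := prod_card_le F G
      have : (4 : ℝ) ^ (n + 1) ≤ djU (n + 1) a b := by
        unfold djU
        have : a - b - 1 = 0 := by omega
        rw [this]
        have p2 : (0 : ℝ) < 3 ^ a * (16 / 9) ^ (n + 1) := by positivity
        have p3 : (0 : ℝ) < 3 ^ (-b) * (16 / 3) ^ (n + 1) := by positivity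
        simp only [zpow_zero, mul_one]
        linarith
      linarith
    have hN := ih (djFib F false ∪ djFib F true) (djFib G false ∪ djFib G true) a (b - 1)
      (by omega) (by
        intro x hx y hy
        simp only [Finset.mem_union, mem_djFib] at hx hy
        rcases hx with hx | hx <;> rcases hy with hy | hy <;>
          · have := h _ hx _ hy
            simp [djDist_cons] at this
            omega)
    have hP := ih (djFib F false ∩ djFib F true) (djFib G false ∪ djFib G true) (a - 1) b
      (by omega) (by
        intro x hx y hy
        simp only [Finset.mem_union, Finset.mem_inter, mem_djFib] at hx hy
        rcases hy with hy | hy <;>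
          · have h1 := h _ hx.1 _ hy
            have h2 := h _ hx.2 _ hy
            simp [djDist_cons] at h1 h2
            omega)
    have hP' := ih (djFib F false ∪ djFib F true) (djFib G false ∩ djFib G true) (a - 1) b
      (by omega) (by
        intro x hx y hy
        simp only [Finset.mem_union, Finset.mem_inter, mem_djFib] at hx hy
        rcases hx with hx | hx <;>
          · have h1 := h _ hx _ hy.1
            have h2 := h _ hx _ hy.2
            simp [djDist_cons] at h1 h2
            omega)
    have cF : (F.card : ℝ) = ((djFib F false ∪ djFib F true).card : ℝ) +
        ((djFib F false ∩ djFib F true).card : ℝ) := by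
      have := card_djFib F
      have h2 := Finset.card_union_add_card_inter (djFib F false) (djFib F true)
      exact_mod_cast this.trans h2.symm
    have cG : (G.card : ℝ) = ((djFib G false ∪ djFib G true).card : ℝ) +
        ((djFib G false ∩ djFib G true).card : ℝ) := by
      have := card_djFib G
      have h2 := Finset.card_union_add_card_inter (djFib G false) (djFib G true)
      exact_mod_cast this.trans h2.symm
    rw [cF, cG]
    have t1 : (0 : ℝ) < 4 ^ n * 3 ^ (a - b) := by positivity
    have t2 : (0 : ℝ) < 3 ^ a * (16 / 9) ^ n + 3 ^ (-b + 1) * (16 / 3) ^ n := by positivity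
    have eX : djU n a (b - 1) = 4 ^ n * 3 ^ (a - b) +
        (3 ^ a * (16 / 9) ^ n + 3 ^ (-b + 1) * (16 / 3) ^ n) := by
      unfold djU
      rw [show a - (b - 1) - 1 = a - b by ring, show -(b - 1) = -b + 1 by ring]; ring
    have three : (3 : ℝ) ≠ 0 := by norm_num
    have eY : djU n (a - 1) b = (4 ^ n * 3 ^ (a - b)) / 9 +
        (3 ^ a * (16 / 9) ^ n + 3 ^ (-b + 1) * (16 / 3) ^ n) / 3 := by
      unfold djU
      rw [show a - 1 - b - 1 = a - b - 2 by ring, zpow_sub₀ three, zpow_sub₀ three a 1,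
        zpow_add₀ three]
      norm_num; ring
    have eU : djU (n + 1) a b = 4 / 3 * (4 ^ n * 3 ^ (a - b)) +
        16 / 9 * (3 ^ a * (16 / 9) ^ n + 3 ^ (-b + 1) * (16 / 3) ^ n) := by
      unfold djU
      rw [zpow_sub₀ three (a - b) 1, zpow_add₀ three]
      norm_num; ring
    rw [eX] at hN
    rw [eY] at hP hP'
    rw [eU]
    generalize (4 : ℝ) ^ n * 3 ^ (a - b) = X1 at *
    generalize (3 : ℝ) ^ a * (16 / 9) ^ n + 3 ^ (-b + 1) * (16 / 3) ^ n = X2 at *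
    refine dist_step _ _ _ _ (X1 + X2) (X1 / 9 + X2 / 3) _ (by positivity) (by positivity)
      ?_ ?_ (by positivity) (by positivity) hN hP hP' ?_
    · exact_mod_cast Finset.card_le_card (Finset.inter_subset_union)
    · exact_mod_cast Finset.card_le_card (Finset.inter_subset_union)
    · nlinarith [mul_pos t1 t2, mul_pos t1 t1]

lemma tail_bound (n m t s : ℕ) (d : ℤ) (hnt : n + t = 4 * m) (ht : t ≤ m)
    (h1 : 2 * (m : ℤ) - t ≤ d) (h2 : d ≤ 2 * m) :
    djU n d (d + 2 * s) ≤ 4 ^ n * ((1 / 9) ^ s / 3 + 2 * (64 / 81) ^ m) := by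
  have three : (3 : ℝ) ≠ 0 := by norm_num
  have e1 : (3 : ℝ) ^ (d - (d + 2 * (s : ℤ)) - 1) = (1 / 9) ^ s / 3 := by
    rw [show d - (d + 2 * (s : ℤ)) - 1 = -((2 * s + 1 : ℕ) : ℤ) by push_cast; ring,
      zpow_neg, zpow_natCast, pow_succ, pow_mul]
    rw [mul_inv, one_div, inv_pow, div_eq_mul_inv]
    norm_num
  have e2 : (3 : ℝ) ^ d * (4 / 9) ^ n ≤ (64 / 81) ^ m := by
    calc (3 : ℝ) ^ d * (4 / 9) ^ n ≤ 3 ^ ((2 * m : ℕ) : ℤ) * (4 / 9) ^ (3 * m) := by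
          apply mul_le_mul
          · exact zpow_le_zpow_right₀ (by norm_num) (by push_cast; exact h2)
          · exact pow_le_pow_of_le_one (by norm_num) (by norm_num) (by omega)
          · positivity
          · positivity
      _ = (64 / 81) ^ m := by
          rw [zpow_natCast, pow_mul, pow_mul, ← mul_pow]; norm_num
  have e3 : (3 : ℝ) ^ (-(d + 2 * (s : ℤ))) * (4 / 3) ^ n ≤ (64 / 81) ^ m := by
    obtain ⟨j, rfl⟩ := Nat.exists_eq_add_of_le ht
    have hn : n = 3 * t + 4 * j := by omega
    subst hn
    calc (3 : ℝ) ^ (-(d + 2 * (s : ℤ))) * (4 / 3) ^ (3 * t + 4 * j)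
        ≤ 3 ^ (-((t + 2 * j : ℕ) : ℤ)) * (4 / 3) ^ (3 * t + 4 * j) := by
          apply mul_le_mul_of_nonneg_right _ (by positivity)
          apply zpow_le_zpow_right₀ (by norm_num)
          push_cast at *
          omega
      _ = (64 / 81) ^ t * (256 / 729) ^ j := by
          rw [zpow_neg, zpow_natCast, ← inv_pow, pow_add, pow_add, pow_mul, pow_mul, pow_mul,
            show (64 / 81 : ℝ) = 3⁻¹ * (4 / 3) ^ 3 by norm_num,
            show (256 / 729 : ℝ) = 3⁻¹ ^ 2 * (4 / 3) ^ 4 by norm_num, mul_pow, mul_pow]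
          ring
      _ ≤ (64 / 81) ^ t * (64 / 81) ^ j := by
          exact mul_le_mul_of_nonneg_left
            (pow_le_pow_left₀ (by norm_num) (by norm_num) j) (by positivity)
      _ = (64 / 81) ^ (t + j) := by rw [pow_add]
  have f2 : (16 / 9 : ℝ) ^ n = 4 ^ n * (4 / 9) ^ n := by rw [← mul_pow]; norm_num
  have f3 : (16 / 3 : ℝ) ^ n = 4 ^ n * (4 / 3) ^ n := by rw [← mul_pow]; norm_num
  unfold djU
  rw [e1, f2, f3]
  have h4 : (0 : ℝ) < 4 ^ n := by positivity
  nlinarith [mul_le_mul_of_nonneg_left e2 h4.le, mul_le_mul_of_nonneg_left e3 h4.le]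

lemma card_slices {n : ℕ} (F : Finset (Fin n → Bool)) :
    (F.card : ℝ) = ∑ k ∈ Finset.range (n + 1), ((F.filter (fun x => djWt x = k)).card : ℝ) := by
  have := Finset.card_eq_sum_card_fiberwise (s := F) (t := Finset.range (n + 1))
    (f := fun x => (djWt x).toNat) (by
      intro x _
      have := djWt_le x
      simp; omega)
  rw [this]
  push_cast
  refine Finset.sum_congr rfl fun k _ => ?_
  congr 2
  ext x
  have := djWt_nonneg x
  simp only [Finset.mem_filter]
  constructor <;> rintro ⟨h, h'⟩ <;> exact ⟨h, by omega⟩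

lemma slice_bound (n m t s : ℕ) (l : ℤ) (hnt : n + t = 4 * m) (ht : t ≤ m)
    (F G : Finset (Fin n → Bool))
    (h : ∀ x ∈ F, ∀ y ∈ G, (djInt x y < l - s ∨ l < djInt x y) ∧
      2 * (m : ℤ) - t ≤ djWt x + djWt y - 2 * l ∧ djWt x + djWt y - 2 * l ≤ 2 * m) :
    (F.card : ℝ) * G.card ≤
      (4 * m + 1) ^ 2 * (4 ^ n * ((1 / 9) ^ s / 3 + 2 * (64 / 81) ^ m)) := by
  set C : ℝ := 4 ^ n * ((1 / 9) ^ s / 3 + 2 * (64 / 81) ^ m) with hC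
  have hCpos : 0 ≤ C := by positivity
  rw [card_slices F, card_slices G, Finset.sum_mul_sum]
  have hterm : ∀ i ∈ Finset.range (n + 1), ∀ j ∈ Finset.range (n + 1),
      ((F.filter (fun x => djWt x = i)).card : ℝ) * ((G.filter (fun x => djWt x = j)).card : ℝ)
        ≤ C := by
    intro i _ j _
    rcases (F.filter (fun x => djWt x = i)).eq_empty_or_nonempty with h0 | ⟨x, hx⟩
    · rw [h0]; simpa using hCpos
    rcases (G.filter (fun x => djWt x = j)).eq_empty_or_nonempty with h0 | ⟨y, hy⟩
    · rw [h0]; simpa using hCpos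
    simp only [Finset.mem_filter] at hx hy
    have hxy := h x hx.1 y hy.1
    rw [hx.2, hy.2] at hxy
    refine le_trans (dist_bound n _ _ ((i : ℤ) + j - 2 * l) ((i : ℤ) + j - 2 * l + 2 * s)
      (by omega) ?_) (tail_bound n m t s _ hnt ht hxy.2.1 hxy.2.2)
    intro u hu v hv
    simp only [Finset.mem_filter] at hu hv
    have huv := (h u hu.1 v hv.1).1
    have := djDist_eq u v
    rw [hu.2, hv.2] at this
    omega
  calc _ ≤ ∑ i ∈ Finset.range (n + 1), ∑ j ∈ Finset.range (n + 1), C :=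
        Finset.sum_le_sum fun i hi => Finset.sum_le_sum fun j hj => hterm i hi j hj
    _ = ((n : ℝ) + 1) ^ 2 * C := by simp; ring
    _ ≤ _ := by
        have : (n : ℝ) ≤ 4 * m := by exact_mod_cast (by omega : n ≤ 4 * m)
        gcongr

/-- The intersection induction. -/
lemma int_bound (m s₀ : ℕ) (c : ℝ) (hc : 0 < c)
    (hA : (2 : ℝ) ^ s₀ ≤ (6 / 5) ^ m * c)
    (hB : (4 * (m : ℝ) + 1) ^ 2 * 2 ^ s₀ * ((1 / 9) ^ s₀ / 3 + 2 * (64 / 81) ^ m) ≤ c)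
    (j : ℕ) : ∀ (n t s : ℕ) (l : ℤ) (F G : Finset (Fin n → Bool)), n = 3 * m + j → t + j = m →
    s ≤ s₀ →
    (∀ x ∈ F, ∀ y ∈ G, (djInt x y < l - s ∨ l < djInt x y) ∧
      2 * (m : ℤ) - t ≤ djWt x + djWt y - 2 * l ∧ djWt x + djWt y - 2 * l ≤ 2 * m) →
    (F.card : ℝ) * G.card ≤ 4 ^ n * c * (1 / 2) ^ s * (6 / 5) ^ t := by
  induction j with
  | zero =>
    intro n t s l F G hn ht hs h
    have ht' : t = m := by omega
    subst ht'
    refine (prod_card_le F G).trans ?_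
    have h1 : (2 : ℝ) ^ s ≤ (6 / 5) ^ t * c :=
      le_trans (pow_le_pow_right₀ (by norm_num) hs) hA
    have h2 : (1 : ℝ) = 2 ^ s * (1 / 2) ^ s := by rw [← mul_pow]; norm_num
    calc (4 : ℝ) ^ n = 4 ^ n * (2 ^ s * (1 / 2) ^ s) := by rw [← h2, mul_one]
      _ ≤ 4 ^ n * (((6 / 5) ^ t * c) * (1 / 2) ^ s) := by gcongr
      _ = _ := by ring
  | succ j ih =>
    intro n t s l F G hn ht hs h
    rcases hs.eq_or_lt with hs | hs
    · subst hs
      refine (slice_bound n m t s l (by omega) (by omega) F G h).trans ?_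
      have h2 : (1 : ℝ) = 2 ^ s * (1 / 2) ^ s := by rw [← mul_pow]; norm_num
      have h3 : (1 : ℝ) ≤ (6 / 5) ^ t := one_le_pow₀ (by norm_num)
      calc (4 * (m : ℝ) + 1) ^ 2 * (4 ^ n * ((1 / 9) ^ s / 3 + 2 * (64 / 81) ^ m))
          = 4 ^ n * ((4 * (m : ℝ) + 1) ^ 2 * ((1 / 9) ^ s / 3 + 2 * (64 / 81) ^ m)) * 1 := by ring
        _ = 4 ^ n * ((4 * (m : ℝ) + 1) ^ 2 * 2 ^ s * ((1 / 9) ^ s / 3 + 2 * (64 / 81) ^ m))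
            * (1 / 2) ^ s * 1 := by
              linear_combination (4 ^ n * ((4 * (m : ℝ) + 1) ^ 2 *
                ((1 / 9) ^ s / 3 + 2 * (64 / 81) ^ m))) * h2
        _ ≤ 4 ^ n * c * (1 / 2) ^ s * (6 / 5) ^ t := by gcongr
    obtain ⟨n, rfl⟩ : ∃ n', n = n' + 1 := ⟨3 * m + j, by omega⟩
    have hn' : n = 3 * m + j := by omega
    have hA1 := ih n (t + 1) s l (djFib F false ∪ djFib F true) (djFib G false) hn' (by omega)
      hs.le (by
        intro x hx y hy
        simp only [Finset.mem_union, mem_djFib] at hx hy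
        rcases hx with hx | hx <;>
          · have := h _ hx _ hy
            simp [djInt_cons, djWt_cons] at this
            push_cast
            omega)
    have hA2 := ih n (t + 1) s l (djFib F false) (djFib G false ∪ djFib G true) hn' (by omega)
      hs.le (by
        intro x hx y hy
        simp only [Finset.mem_union, mem_djFib] at hx hy
        rcases hy with hy | hy <;>
          · have := h _ hx _ hy
            simp [djInt_cons, djWt_cons] at this
            push_cast
            omega)
    have hB1 := ih n (t + 1) (s + 1) l (djFib F false ∩ djFib F true) (djFib G true) hn' (by omega)
      hs (by
        intro x hx y hy
        simp only [Finset.mem_inter, mem_djFib] at hx hy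
        have h1 := h _ hx.1 _ hy
        have h2 := h _ hx.2 _ hy
        simp [djInt_cons, djWt_cons] at h1 h2
        push_cast
        omega)
    have hB2 := ih n (t + 1) (s + 1) l (djFib F true) (djFib G false ∩ djFib G true) hn' (by omega)
      hs (by
        intro x hx y hy
        simp only [Finset.mem_inter, mem_djFib] at hx hy
        have h1 := h _ hx _ hy.1
        have h2 := h _ hx _ hy.2
        simp [djInt_cons, djWt_cons] at h1 h2
        push_cast
        omega)
    have hZ := ih n (t + 1) s (l - 1) (djFib F true) (djFib G true) hn' (by omega)
      hs.le (by
        intro x hx y hy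
        simp only [mem_djFib] at hx hy
        have := h _ hx _ hy
        simp [djInt_cons, djWt_cons] at this
        push_cast
        omega)
    have cF := card_djFib F
    have cF' := Finset.card_union_add_card_inter (djFib F false) (djFib F true)
    have cG := card_djFib G
    have cG' := Finset.card_union_add_card_inter (djFib G false) (djFib G true)
    have iF := Finset.card_le_card
      (Finset.inter_subset_union (s := djFib F false) (t := djFib F true))
    have iG := Finset.card_le_card
      (Finset.inter_subset_union (s := djFib G false) (t := djFib G true))
    refine int_step (F.card : ℝ) (djFib F false).card (djFib F true).card
      (djFib F false ∪ djFib F true).card (djFib F false ∩ djFib F true).card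
      (G.card : ℝ) (djFib G false).card (djFib G true).card
      (djFib G false ∪ djFib G true).card (djFib G false ∩ djFib G true).card _
      (by exact_mod_cast cF) (by exact_mod_cast cF.trans cF'.symm)
      (by exact_mod_cast cG) (by exact_mod_cast cG.trans cG'.symm)
      (by positivity) (by positivity) (by positivity) (by exact_mod_cast iF)
      (by positivity) (by positivity) (by positivity) (by exact_mod_cast iG)
      (hA1.trans_eq ?_) (hB1.trans_eq ?_) (hA2.trans_eq ?_) (hB2.trans_eq ?_) (hZ.trans_eq ?_)
      (by positivity) <;> · rw [pow_succ, pow_succ]; ring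

lemma poly_exp (s : ℕ) (hs : 15 ≤ s) : (40 * (s : ℝ) + 37) ^ 2 * (67 / 200) ^ s ≤ 1 / 10 := by
  induction s, hs using Nat.le_induction with
  | base => norm_num
  | succ s hs ih =>
    have h15 : (15 : ℝ) ≤ s := by exact_mod_cast hs
    have : (40 * ((s + 1 : ℕ) : ℝ) + 37) ^ 2 * (67 / 200) ≤ (40 * (s : ℝ) + 37) ^ 2 := by
      push_cast; nlinarith
    calc (40 * ((s + 1 : ℕ) : ℝ) + 37) ^ 2 * (67 / 200) ^ (s + 1)
        = ((40 * ((s + 1 : ℕ) : ℝ) + 37) ^ 2 * (67 / 200)) * (67 / 200) ^ s := by ring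
      _ ≤ (40 * (s : ℝ) + 37) ^ 2 * (67 / 200) ^ s := by gcongr
      _ ≤ _ := ih

lemma numericA (m s : ℕ) (h : 10 * s ≤ m) :
    (2 : ℝ) ^ s ≤ (6 / 5) ^ m * ((199 / 200) ^ 8) ^ m := by
  rw [← mul_pow]
  calc (2 : ℝ) ^ s ≤ ((6 / 5 * (199 / 200) ^ 8) ^ 10) ^ s := by gcongr; norm_num
    _ = (6 / 5 * (199 / 200) ^ 8) ^ (10 * s) := by rw [← pow_mul]
    _ ≤ _ := pow_le_pow_right₀ (by norm_num) h

lemma numericB (m s : ℕ) (hs : 15 ≤ s) (h : 10 * s ≤ m) (h' : m ≤ 10 * s + 9) :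
    (4 * (m : ℝ) + 1) ^ 2 * 2 ^ s * ((1 / 9) ^ s / 3 + 2 * (64 / 81) ^ m)
      ≤ ((199 / 200) ^ 8) ^ m := by
  have hm : (m : ℝ) ≤ 10 * s + 9 := by exact_mod_cast h'
  set k : ℝ := (199 / 200) ^ 8 with hk
  have hP := poly_exp s hs
  have hk0 : 0 < k := by positivity
  have h1 : (2 : ℝ) ^ s * (1 / 9) ^ s ≤ 3 / 2 * ((67 / 200) ^ s * k ^ m) := by
    have a1 : k ^ (10 * s + 9) ≤ k ^ m :=
      pow_le_pow_of_le_one hk0.le (by rw [hk]; norm_num) h'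
    have a2 : (2 : ℝ) ^ s * (1 / 9) ^ s ≤ (67 / 200) ^ s * (k ^ 10) ^ s := by
      rw [← mul_pow, ← mul_pow]
      exact pow_le_pow_left₀ (by norm_num) (by rw [hk]; norm_num) s
    have a3 : k ^ (10 * s + 9) = (k ^ 10) ^ s * k ^ 9 := by rw [pow_add, pow_mul]
    have a4 : 2 / 3 ≤ k ^ 9 := by rw [hk]; norm_num
    have a5 : (k ^ 10) ^ s * (2 / 3) ≤ k ^ m := by
      refine le_trans ?_ a1; rw [a3]; gcongr
    have a6 : (0 : ℝ) < (67 / 200) ^ s := by positivity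
    nlinarith [mul_le_mul_of_nonneg_left a5 a6.le]
  have h2 : (2 : ℝ) ^ s * (64 / 81) ^ m ≤ (67 / 200) ^ s * k ^ m := by
    have b1 : (64 / 81 : ℝ) ^ m = (64 / 81 / k) ^ m * k ^ m := by
      rw [← mul_pow]; congr 1; field_simp
    have b2 : (64 / 81 / k) ^ m ≤ (64 / 81 / k) ^ (10 * s) :=
      pow_le_pow_of_le_one (by positivity) (by rw [hk]; norm_num) h
    have b3 : (2 : ℝ) ^ s * (64 / 81 / k) ^ (10 * s) ≤ (67 / 200) ^ s := by
      rw [pow_mul, ← mul_pow]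
      gcongr
      rw [hk]; norm_num
    calc (2 : ℝ) ^ s * (64 / 81) ^ m = 2 ^ s * (64 / 81 / k) ^ m * k ^ m := by rw [b1]; ring
      _ ≤ 2 ^ s * (64 / 81 / k) ^ (10 * s) * k ^ m := by gcongr
      _ ≤ _ := by gcongr
  have hq : (4 * (m : ℝ) + 1) ^ 2 ≤ (40 * (s : ℝ) + 37) ^ 2 := by
    exact pow_le_pow_left₀ (by positivity) (by linarith) 2
  have hkm : 0 < k ^ m := by positivity
  calc (4 * (m : ℝ) + 1) ^ 2 * 2 ^ s * ((1 / 9) ^ s / 3 + 2 * (64 / 81) ^ m)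
      = (4 * (m : ℝ) + 1) ^ 2 * ((2 ^ s * (1 / 9) ^ s) / 3 + 2 * (2 ^ s * (64 / 81) ^ m)) := by ring
    _ ≤ (40 * (s : ℝ) + 37) ^ 2 * ((3 / 2 * ((67 / 200) ^ s * k ^ m)) / 3
        + 2 * ((67 / 200) ^ s * k ^ m)) := by gcongr
    _ = 5 / 2 * ((40 * (s : ℝ) + 37) ^ 2 * (67 / 200) ^ s) * k ^ m := by ring
    _ ≤ 5 / 2 * (1 / 10) * k ^ m := by gcongr
    _ ≤ k ^ m := mul_le_of_le_one_left hkm.le (by norm_num)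

lemma centralBinom_sq (k : ℕ) : (2 * k + 1) * k.centralBinom ^ 2 ≤ 16 ^ k := by
  induction k with
  | zero => simp
  | succ k ih =>
    have h := Nat.succ_mul_centralBinom_succ k
    have h2 : (k + 1) ^ 2 * ((2 * (k + 1) + 1) * (k + 1).centralBinom ^ 2)
        = (2 * k + 3) * ((k + 1) * (k + 1).centralBinom) ^ 2 := by ring
    have : (k + 1) ^ 2 * ((2 * (k + 1) + 1) * (k + 1).centralBinom ^ 2)
        ≤ (k + 1) ^ 2 * 16 ^ (k + 1) := by
      rw [h2, h]
      calc (2 * k + 3) * (2 * (2 * k + 1) * k.centralBinom) ^ 2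
          = 4 * ((2 * k + 3) * (2 * k + 1)) * ((2 * k + 1) * k.centralBinom ^ 2) := by ring
        _ ≤ 4 * (4 * (k + 1) ^ 2) * 16 ^ k := by
            apply Nat.mul_le_mul _ ih
            apply Nat.mul_le_mul_left
            nlinarith
        _ = _ := by ring
    exact Nat.le_of_mul_le_mul_left this (by positivity)

lemma small_up (m : ℕ) (hm : m ≤ 24) : (1 : ℝ) ≤ (4 * m + 1) * (24 / 25) ^ m := by
  induction m with
  | zero => simp
  | succ m ih =>
    have h := ih (by omega)
    have hm' : (m : ℝ) ≤ 23 := by exact_mod_cast (by omega : m ≤ 23)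
    have hp : (0 : ℝ) < (24 / 25) ^ m := by positivity
    rw [pow_succ]
    push_cast
    nlinarith

lemma small_down (j : ℕ) : ∀ m : ℕ, 24 ≤ m → m + j = 149 →
    (1 : ℝ) ≤ (4 * m + 1) * (24 / 25) ^ m := by
  induction j with
  | zero =>
    intro m _ h
    have : m = 149 := by omega
    subst this
    norm_num
  | succ j ih =>
    intro m hm h
    have h1 := ih (m + 1) (by omega) (by omega)
    have hm' : (24 : ℝ) ≤ m := by exact_mod_cast hm
    have hp : (0 : ℝ) < (24 / 25) ^ m := by positivity
    rw [pow_succ] at h1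
    push_cast at h1
    nlinarith

lemma small_numeric (m : ℕ) (hm : m < 150) :
    (16 : ℝ) ^ (2 * m) * 100 ^ (8 * m) ≤ (4 * m + 1) * 199 ^ (8 * m) := by
  have h1 : (1 : ℝ) ≤ (4 * m + 1) * (24 / 25) ^ m := by
    rcases le_total m 24 with h | h
    · exact small_up m h
    · exact small_down (149 - m) m h (by omega)
  have h2 : (24 / 25 : ℝ) ^ m * (16 ^ (2 * m) * 100 ^ (8 * m)) ≤ 199 ^ (8 * m) := by
    rw [pow_mul, pow_mul, pow_mul, ← mul_pow, ← mul_pow]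
    exact pow_le_pow_left₀ (by positivity) (by norm_num) m
  have h3 : (0 : ℝ) < 16 ^ (2 * m) * 100 ^ (8 * m) := by positivity
  calc (16 : ℝ) ^ (2 * m) * 100 ^ (8 * m) = 1 * (16 ^ (2 * m) * 100 ^ (8 * m)) := by ring
    _ ≤ ((4 * m + 1) * (24 / 25) ^ m) * (16 ^ (2 * m) * 100 ^ (8 * m)) :=
        mul_le_mul_of_nonneg_right h1 h3.le
    _ = (4 * m + 1) * ((24 / 25) ^ m * (16 ^ (2 * m) * 100 ^ (8 * m))) := by ring
    _ ≤ _ := mul_le_mul_of_nonneg_left h2 (by positivity)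

lemma small_case (m : ℕ) (hm : m < 150) :
    ((4 * m).choose (2 * m) : ℝ) ≤ 1.99 ^ (4 * m) := by
  have h1 := centralBinom_sq (2 * m)
  rw [Nat.centralBinom_eq_two_mul_choose, show 2 * (2 * m) = 4 * m by ring] at h1
  have h2 := small_numeric m hm
  have h1' : (4 * (m : ℝ) + 1) * ((4 * m).choose (2 * m) : ℝ) ^ 2 ≤ 16 ^ (2 * m) := by
    exact_mod_cast h1
  have h2' : (16 : ℝ) ^ (2 * m) * 100 ^ (8 * m) ≤ (4 * m + 1) * 199 ^ (8 * m) := h2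
  have h3 : (1.99 : ℝ) ^ (8 * m) * 100 ^ (8 * m) = 199 ^ (8 * m) := by
    rw [← mul_pow]; norm_num
  have hp : (0 : ℝ) < 100 ^ (8 * m) := by positivity
  have h4 : (16 : ℝ) ^ (2 * m) ≤ (4 * m + 1) * 1.99 ^ (8 * m) := by
    rw [← h3, ← mul_assoc] at h2'
    exact le_of_mul_le_mul_right h2' hp
  have h5 : ((4 * m).choose (2 * m) : ℝ) ^ 2 ≤ (1.99 ^ (4 * m)) ^ 2 := by
    rw [← pow_mul, show 4 * m * 2 = 8 * m by ring]
    exact le_of_mul_le_mul_left (h1'.trans h4) (by positivity)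
  exact (sq_le_sq₀ (by positivity) (by positivity)).1 h5

lemma card_filter_int {n : ℕ} (p : Fin n → Prop) [DecidablePred p] :
    ((Finset.univ.filter p).card : ℤ) = ∑ i, if p i then 1 else 0 := by
  simp

lemma card_halfWeight (n k : ℕ) :
    (Finset.univ.filter (fun x : Fin n → Bool =>
      (Finset.univ.filter (fun i => x i = true)).card = k)).card = n.choose k := by
  have h := Finset.card_powersetCard k (Finset.univ : Finset (Fin n))
  rw [Finset.card_fin] at h
  rw [← h]
  refine Finset.card_bij (fun x _ => Finset.univ.filter (fun i => x i = true)) ?_ ?_ ?_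
  · intro x hx
    simp only [Finset.mem_filter, Finset.mem_univ, true_and] at hx
    rw [Finset.mem_powersetCard]
    exact ⟨Finset.subset_univ _, hx⟩
  · intro x _ y _ hxy
    funext i
    have := Finset.ext_iff.1 hxy i
    simp only [Finset.mem_filter, Finset.mem_univ, true_and] at this
    cases hx : x i <;> cases hy : y i <;> simp_all
  · intro t ht
    rw [Finset.mem_powersetCard] at ht
    refine ⟨fun i => decide (i ∈ t), ?_, ?_⟩
    · simp [ht.2]
    · ext i; simp

lemma family_bound (m : ℕ) (S : Finset (Fin (4 * m) → Bool))
    (hS : ∀ x ∈ S, (Finset.univ.filter (fun i => x i = true)).card = 2 * m)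
    (hd : ∀ x ∈ S, ∀ y ∈ S, (Finset.univ.filter (fun i => x i ≠ y i)).card ≠ 2 * m) :
    (S.card : ℝ) ≤ 1.99 ^ (4 * m) := by
  rcases lt_or_ge m 150 with hm | hm
  · refine le_trans ?_ (small_case m hm)
    rw [← card_halfWeight]
    exact_mod_cast Finset.card_le_card (fun x hx => by simpa using hS x hx)
  have hwt : ∀ x ∈ S, djWt x = 2 * m := by
    intro x hx
    have := hS x hx
    unfold djWt
    rw [← card_filter_int, this]; push_cast; ring
  have hb := int_bound m (m / 10) (((199 / 200) ^ 8) ^ m) (by positivity)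
    (numericA m _ (by omega)) (numericB m _ (by omega) (by omega) (by omega))
    m (4 * m) 0 0 (m : ℤ) S S (by ring) (by ring) (by omega) (by
      intro x hx y hy
      have h1 := hwt x hx
      have h2 := hwt y hy
      have h3 := djDist_eq x y
      have h4 : djDist x y ≠ 2 * m := by
        unfold djDist
        rw [← card_filter_int]
        exact_mod_cast hd x hx y hy
      push_cast
      omega)
  simp only [pow_zero, mul_one] at hb
  have : (S.card : ℝ) ^ 2 ≤ (1.99 ^ (4 * m)) ^ 2 := by
    calc (S.card : ℝ) ^ 2 = S.card * S.card := by ring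
      _ ≤ _ := hb
      _ = ((4 : ℝ) ^ 4 * (199 / 200) ^ 8) ^ m := by rw [mul_pow, pow_mul]
      _ = (1.99 ^ 8) ^ m := by norm_num
      _ = _ := by rw [← pow_mul, ← pow_mul]; congr 1; ring
  exact (sq_le_sq₀ (by positivity) (by positivity)).1 this

/-- Classical lower bound for the Distributed Deutsch-Jozsa problem (rectangle
form): if a finite family of rectangles `A k × B k` covers every diagonal pair
`(x,x)` with `x` of Hamming weight `n/2`, and no rectangle containing such a
diagonal pair also contains a pair of weight-`n/2` strings at Hamming distance
exactly `n/2`, then the number of rectangles times `1.99^n` is at least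
`n choose n/2`. -/
theorem dj_rectangle_lower_bound (n : ℕ) (hn : 0 < n) (h4 : 4 ∣ n)
    (ι : Type) [Fintype ι] (A B : ι → Set (Fin n → Bool))
    (hcover : ∀ x ∈ halfWeight n, ∃ k, x ∈ A k ∧ x ∈ B k)
    (hmono : ∀ k, ∀ x ∈ halfWeight n, x ∈ A k → x ∈ B k →
      ∀ y ∈ halfWeight n, ∀ z ∈ halfWeight n, y ∈ A k → z ∈ B k →
        (Finset.univ.filter (fun i => y i ≠ z i)).card ≠ n / 2) :
    (n.choose (n / 2) : ℝ) ≤ (Fintype.card ι : ℝ) * 1.99 ^ n := by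
  classical
  obtain ⟨m, rfl⟩ := h4
  have h2 : 4 * m / 2 = 2 * m := by omega
  have hmem : ∀ x : Fin (4 * m) → Bool, x ∈ halfWeight (4 * m) ↔
      (Finset.univ.filter (fun i => x i = true)).card = 2 * m := by
    intro x; simp only [halfWeight, Set.mem_ofPred_eq, h2]
  rw [h2] at hmono ⊢
  let S : ι → Finset (Fin (4 * m) → Bool) := fun k =>
    Finset.univ.filter (fun x => x ∈ halfWeight (4 * m) ∧ x ∈ A k ∧ x ∈ B k)
  have hSmem : ∀ k x, x ∈ S k ↔ x ∈ halfWeight (4 * m) ∧ x ∈ A k ∧ x ∈ B k := by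
    intro k x; simp [S]
  have hb : ∀ k, ((S k).card : ℝ) ≤ 1.99 ^ (4 * m) := by
    intro k
    refine family_bound m (S k) (fun x hx => (hmem x).1 ((hSmem k x).1 hx).1) ?_
    intro x hx y hy
    have hx := (hSmem k x).1 hx
    have hy := (hSmem k y).1 hy
    exact hmono k x hx.1 hx.2.1 hx.2.2 x hx.1 y hy.1 hx.2.1 hy.2.2
  have hcard : (4 * m).choose (2 * m) ≤ ∑ k, (S k).card := by
    rw [← card_halfWeight]
    refine le_trans (Finset.card_le_card ?_) Finset.card_biUnion_le
    intro x hx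
    have hx' : x ∈ halfWeight (4 * m) := (hmem x).2 (by simpa using hx)
    obtain ⟨k, hk⟩ := hcover x hx'
    exact Finset.mem_biUnion.2 ⟨k, Finset.mem_univ k, (hSmem k x).2 ⟨hx', hk⟩⟩
  calc ((4 * m).choose (2 * m) : ℝ) ≤ ∑ k, ((S k).card : ℝ) := by exact_mod_cast hcard
    _ ≤ ∑ _k : ι, (1.99 : ℝ) ^ (4 * m) := Finset.sum_le_sum fun k _ => hb k
    _ = _ := by simp
end

section
/- Lindsey's lemma: Let n be a natural number and let A, B be finite sets of vectors in (Fin n → ℤ/2ℤ). Then |∑_{x ∈ A} ∑_{y ∈ B} (−1)^{x·y}| ≤ √(|A| · |B| · 2^n), where x·y = ∑_i x_i y_i ∈ ℤ/2ℤ, (−1)^z for z ∈ ℤ/2ℤ denotes (−1)^{z.val} ∈ ℝ, and the sum is over all pairs in the rectangle A × B. -/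
open Finset

lemma lindsey_chi_add (a b : ZMod 2) :
    (-1 : ℝ) ^ (a + b).val = (-1 : ℝ) ^ a.val * (-1 : ℝ) ^ b.val := by
  rw [ZMod.val_add, ← pow_add, ← neg_one_pow_eq_pow_mod_two]

lemma lindsey_chi_sum {n : ℕ} (f : Fin n → ZMod 2) :
    (-1 : ℝ) ^ (∑ i, f i).val = ∏ i, (-1 : ℝ) ^ (f i).val := by
  classical
  induction (univ : Finset (Fin n)) using Finset.induction_on with
  | empty => simp
  | insert a s ha ih => rw [sum_insert ha, prod_insert ha, lindsey_chi_add, ih]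

lemma lindsey_coord (b c : ZMod 2) :
    ∑ a : ZMod 2, (-1 : ℝ) ^ (a * b).val * (-1 : ℝ) ^ (a * c).val = if b = c then 2 else 0 := by
  have h : ∀ a : ZMod 2, (-1 : ℝ) ^ (a * b).val * (-1 : ℝ) ^ (a * c).val
      = (-1 : ℝ) ^ (a * (b + c)).val := by
    intro a
    rw [mul_add, lindsey_chi_add]
  simp_rw [h]
  have hu : (univ : Finset (ZMod 2)) = {0, 1} := by decide
  have hd : b = c ∧ b + c = 0 ∨ b ≠ c ∧ b + c = 1 := by
    clear h; revert b c; decide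
  have h1 : (1 : ZMod 2).val = 1 := rfl
  rw [hu, sum_pair (by decide)]
  rcases hd with ⟨e, h⟩ | ⟨e, h⟩
  · rw [h, if_pos e]; norm_num
  · rw [h, if_neg e, mul_one, mul_one, h1]; norm_num

lemma lindsey_orth {n : ℕ} (y z : Fin n → ZMod 2) :
    ∑ x : Fin n → ZMod 2, (-1 : ℝ) ^ (∑ i, x i * y i).val * (-1 : ℝ) ^ (∑ i, x i * z i).val
      = if y = z then 2 ^ n else 0 := by
  simp_rw [lindsey_chi_sum, ← prod_mul_distrib]
  have h := Finset.prod_univ_sum (fun _ : Fin n => (univ : Finset (ZMod 2)))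
    (fun i a => (-1 : ℝ) ^ (a * y i).val * (-1 : ℝ) ^ (a * z i).val)
  rw [Fintype.piFinset_univ] at h
  rw [← h]
  simp_rw [lindsey_coord]
  split_ifs with e
  · subst e; simp
  · obtain ⟨i, hi⟩ := Function.ne_iff.mp e
    exact prod_eq_zero (mem_univ i) (if_neg hi)

/-- Lindsey's lemma: the sum of the entries `(−1)^{x·y}` of the ±1 inner
product matrix over any rectangle `A × B` is at most `√(|A|·|B|·2^n)` in
absolute value. -/
theorem lindsey_lemma (n : ℕ) (A B : Finset (Fin n → ZMod 2)) :
    |∑ x ∈ A, ∑ y ∈ B, (-1 : ℝ) ^ (∑ i, x i * y i).val| ≤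
      Real.sqrt (A.card * B.card * 2 ^ n) := by
  apply Real.abs_le_sqrt
  refine sq_sum_le_card_mul_sum_sq.trans ?_
  rw [mul_assoc]
  refine mul_le_mul_of_nonneg_left ?_ (Nat.cast_nonneg _)
  refine (sum_le_sum_of_subset_of_nonneg (subset_univ A) fun _ _ _ => sq_nonneg _).trans ?_
  apply le_of_eq
  simp_rw [sq, sum_mul_sum]
  rw [sum_comm]
  have h : ∀ y ∈ B, ∑ x : Fin n → ZMod 2, ∑ z ∈ B,
      (-1 : ℝ) ^ (∑ i, x i * y i).val * (-1 : ℝ) ^ (∑ i, x i * z i).val = 2 ^ n := by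
    intro y hy
    rw [sum_comm]
    simp_rw [lindsey_orth]
    simp [hy]
  rw [sum_congr rfl h]
  simp
end

section
/- Discrepancy of the inner product function: Let n be a natural number. For all finite sets A, B of vectors in (Fin n → ℤ/2ℤ), | #{(x,y) ∈ A × B : x·y = 0} − #{(x,y) ∈ A × B : x·y = 1} | ≤ √(2^{3n}), where x·y = ∑_i x_i y_i ∈ ℤ/2ℤ. Equivalently, the discrepancy of the inner product function under the uniform distribution is at most 2^{−n/2}: dividing by 2^{2n}, every rectangle has weighted imbalance at most 2^{−n/2}. -/
open Finset

/-- The sign character of `ZMod 2`. -/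
def ipSign (a : ZMod 2) : ℝ := if a = 0 then 1 else -1

lemma ipSign_add (a b : ZMod 2) : ipSign (a + b) = ipSign a * ipSign b := by
  have h2 : (1 + 1 : ZMod 2) = 0 := by decide
  have h : ∀ a : ZMod 2, a = 0 ∨ a = 1 := by decide
  rcases h a with rfl | rfl <;> rcases h b with rfl | rfl <;> simp [ipSign, h2]

lemma ipSign_orth (n : ℕ) (z : Fin n → ZMod 2) (hz : z ≠ 0) :
    ∑ x : Fin n → ZMod 2, ipSign (∑ i, x i * z i) = 0 := by
  obtain ⟨j, hj⟩ := Function.ne_iff.mp hz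
  have h : ∀ a : ZMod 2, a = 0 ∨ a = 1 := by decide
  have hj1 : z j = 1 := (h (z j)).resolve_left hj
  have key := Equiv.sum_comp (Equiv.addRight (Pi.single j 1 : Fin n → ZMod 2))
    (fun x => ipSign (∑ i, x i * z i))
  have e : ∀ x : Fin n → ZMod 2,
      ipSign (∑ i, (Equiv.addRight (Pi.single j 1 : Fin n → ZMod 2) x) i * z i)
        = - ipSign (∑ i, x i * z i) := by
    intro x
    have : ∑ i, (Equiv.addRight (Pi.single j 1 : Fin n → ZMod 2) x) i * z i
        = ∑ i, x i * z i + 1 := by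
      simp [add_mul, Finset.sum_add_distrib, Pi.single_apply, hj1]
    rw [this, ipSign_add]
    simp [ipSign]
  simp only [e, Finset.sum_neg_distrib] at key
  linarith

lemma ipSign_second_moment (n : ℕ) (B : Finset (Fin n → ZMod 2)) :
    ∑ x : Fin n → ZMod 2, (∑ y ∈ B, ipSign (∑ i, x i * y i)) ^ 2 = 2 ^ n * (B.card : ℝ) := by
  have h1 : ∀ x : Fin n → ZMod 2, (∑ y ∈ B, ipSign (∑ i, x i * y i)) ^ 2
      = ∑ y ∈ B, ∑ y' ∈ B, ipSign (∑ i, x i * (y + y') i) := by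
    intro x
    rw [sq, Finset.sum_mul_sum]
    refine Finset.sum_congr rfl fun y _ => Finset.sum_congr rfl fun y' _ => ?_
    rw [← ipSign_add, ← Finset.sum_add_distrib]
    simp [mul_add]
  simp only [h1]
  rw [Finset.sum_comm]
  have h2 : ∀ y ∈ B, ∑ x : Fin n → ZMod 2, ∑ y' ∈ B, ipSign (∑ i, x i * (y + y') i)
      = 2 ^ n := by
    intro y hy
    rw [Finset.sum_comm, Finset.sum_eq_single_of_mem y hy]
    · have : y + y = 0 := by
        funext i
        exact CharTwo.add_self_eq_zero (y i)
      rw [this]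
      simp [ipSign]
    · intro y' _ hne
      apply ipSign_orth
      intro h0
      apply hne
      funext i
      have := congrFun h0 i
      exact (CharTwo.add_eq_zero.mp this).symm
  rw [Finset.sum_congr rfl h2]
  simp [mul_comm]

/-- Discrepancy of the inner product function: in every rectangle `A × B`,
the number of pairs with inner product 0 and the number of pairs with inner
product 1 differ by at most `√(2^{3n})`; dividing by `2^{2n}`, every rectangle
has weighted imbalance at most `2^{−n/2}`. -/
theorem inner_product_discrepancy (n : ℕ) (A B : Finset (Fin n → ZMod 2)) :
    |((((A ×ˢ B).filter (fun p => ∑ i, p.1 i * p.2 i = 0)).card : ℝ) -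
        (((A ×ˢ B).filter (fun p => ∑ i, p.1 i * p.2 i = 1)).card : ℝ))| ≤
      Real.sqrt (2 ^ (3 * n)) := by
  have hS : ((((A ×ˢ B).filter (fun p => ∑ i, p.1 i * p.2 i = 0)).card : ℝ) -
        (((A ×ˢ B).filter (fun p => ∑ i, p.1 i * p.2 i = 1)).card : ℝ))
      = ∑ x ∈ A, ∑ y ∈ B, ipSign (∑ i, x i * y i) := by
    rw [← Finset.sum_product', Finset.card_filter, Finset.card_filter]
    push_cast
    rw [← Finset.sum_sub_distrib]
    refine Finset.sum_congr rfl fun p _ => ?_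
    have h : ∀ a : ZMod 2, a = 0 ∨ a = 1 := by decide
    rcases h (∑ i, p.1 i * p.2 i) with h | h <;> simp [h, ipSign]
  have hc : ∀ C : Finset (Fin n → ZMod 2), (C.card : ℝ) ≤ 2 ^ n := by
    intro C
    have := Finset.card_le_univ C
    simp at this
    exact_mod_cast this
  rw [hS]
  apply Real.abs_le_sqrt
  calc (∑ x ∈ A, ∑ y ∈ B, ipSign (∑ i, x i * y i)) ^ 2
      ≤ A.card * ∑ x ∈ A, (∑ y ∈ B, ipSign (∑ i, x i * y i)) ^ 2 := sq_sum_le_card_mul_sum_sq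
    _ ≤ 2 ^ n * ∑ x : Fin n → ZMod 2, (∑ y ∈ B, ipSign (∑ i, x i * y i)) ^ 2 := by
        apply mul_le_mul (hc A) _ (Finset.sum_nonneg fun _ _ => sq_nonneg _) (by positivity)
        exact Finset.sum_le_sum_of_subset_of_nonneg (Finset.subset_univ A)
          fun _ _ _ => sq_nonneg _
    _ = 2 ^ n * (2 ^ n * (B.card : ℝ)) := by rw [ipSign_second_moment]
    _ ≤ 2 ^ n * (2 ^ n * 2 ^ n) := by
        gcongr
        exact hc B
    _ = 2 ^ (3 * n) := by ring
end

section
/- Nayak's consequence of Holevo's bound: Let n, d be natural numbers with d ≥ 1, let N = 2^n, let ρ : Fin N → Matrix (Fin d) (Fin d) ℂ be a family of density matrices (each ρ x positive semidefinite with trace 1), and let E : Fin N → Matrix (Fin d) (Fin d) ℂ be a measurement (each E x positive semidefinite, with ∑_x E x equal to the identity matrix). Then (1/N) · ∑_{x} Re(trace(E x · ρ x)) ≤ d/N. In particular, if n-bit strings are encoded into d-dimensional quantum states, the average probability of correctly recovering a uniformly random string is at most d/2^n, so exact recovery requires d ≥ 2^n, i.e., at least n qubits. -/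
open Matrix ComplexOrder

open scoped MatrixOrder in
lemma exists_factor {d : ℕ} {A : Matrix (Fin d) (Fin d) ℂ} (hA : A.PosSemidef) :
    ∃ P : Matrix (Fin d) (Fin d) ℂ, A = Pᴴ * P :=
  CStarAlgebra.nonneg_iff_eq_star_mul_self.mp hA.nonneg

section helpers
attribute [local instance] Matrix.frobeniusNormedAddCommGroup

lemma re_trace_mul_conjTranspose {d : ℕ} (M : Matrix (Fin d) (Fin d) ℂ) :
    (M * Mᴴ).trace.re = ‖M‖ ^ 2 := by
  have h0 : (0 : ℝ) ≤ ∑ i, ∑ j, ‖M i j‖ ^ 2 := by positivity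
  rw [Matrix.frobenius_norm_def]
  simp only [Real.rpow_two]
  rw [← Real.sqrt_eq_rpow, Real.sq_sqrt h0]
  simp only [Matrix.trace, Matrix.diag, Matrix.mul_apply, Matrix.conjTranspose_apply,
    Complex.re_sum]
  refine Finset.sum_congr rfl fun i _ => Finset.sum_congr rfl fun j _ => ?_
  rw [Complex.star_def, Complex.mul_conj, Complex.normSq_eq_norm_sq, Complex.ofReal_re]

lemma re_trace_mul_le {d : ℕ} {A B : Matrix (Fin d) (Fin d) ℂ}
    (hA : A.PosSemidef) (hB : B.PosSemidef) :
    (A * B).trace.re ≤ A.trace.re * B.trace.re := by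
  obtain ⟨P, rfl⟩ := exists_factor hA
  obtain ⟨Q, rfl⟩ := exists_factor hB
  have h1 : (Pᴴ * P * (Qᴴ * Q)).trace = ((P * Qᴴ) * (P * Qᴴ)ᴴ).trace := by
    rw [Matrix.conjTranspose_mul, Matrix.conjTranspose_conjTranspose, Matrix.mul_assoc,
      Matrix.trace_mul_comm]
    simp only [Matrix.mul_assoc]
  rw [h1, Matrix.trace_mul_comm Pᴴ, Matrix.trace_mul_comm Qᴴ, re_trace_mul_conjTranspose,
    re_trace_mul_conjTranspose, re_trace_mul_conjTranspose, ← mul_pow]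
  have h2 := Matrix.frobenius_norm_mul P Qᴴ
  rw [Matrix.frobenius_norm_conjTranspose] at h2
  exact pow_le_pow_left₀ (norm_nonneg _) h2 2

end helpers

/-- Nayak's consequence of Holevo's bound: if the `2^n` strings are encoded as
`d`-dimensional density matrices `ρ x` and decoded with a POVM `E`, then the
average recovery probability `(1/2^n)·∑_x tr(E x · ρ x)` is at most `d/2^n`. -/
theorem nayak_holevo_bound (n d : ℕ) (hd : 1 ≤ d)
    (ρ : Fin (2 ^ n) → Matrix (Fin d) (Fin d) ℂ)
    (E : Fin (2 ^ n) → Matrix (Fin d) (Fin d) ℂ)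
    (hρ : ∀ x, (ρ x).PosSemidef) (hρtr : ∀ x, (ρ x).trace = 1)
    (hE : ∀ x, (E x).PosSemidef) (hEsum : ∑ x, E x = 1) :
    (1 / (2 ^ n : ℝ)) * ∑ x, ((E x * ρ x).trace).re ≤ (d : ℝ) / 2 ^ n := by
  have h : ∑ x, ((E x * ρ x).trace).re ≤ (d : ℝ) := by
    calc ∑ x, ((E x * ρ x).trace).re ≤ ∑ x, (E x).trace.re := by
          refine Finset.sum_le_sum fun x _ => ?_
          have := re_trace_mul_le (hE x) (hρ x)
          rwa [hρtr x, Complex.one_re, mul_one] at this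
      _ = (∑ x, E x).trace.re := by rw [Matrix.trace_sum, Complex.re_sum]
      _ = d := by rw [hEsum]; simp
  rw [one_div, inv_mul_eq_div]
  gcongr
end

section
/- Theorem of Ehlich–Zeller and Rivlin–Cheney: Let p be a polynomial with real coefficients, let N be a positive natural number, let b₁ ≤ b₂ be reals, and let c > 0 be real. Suppose b₁ ≤ p(i) ≤ b₂ for every natural number i with 0 ≤ i ≤ N, and suppose there exists a real x with 0 ≤ x ≤ N such that |p'(x)| ≥ c. Then the degree of p satisfies (deg p)² ≥ c·N/(c + b₂ − b₁). -/
open Polynomial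

namespace MarkovAux

open Polynomial.Chebyshev Real

lemma T_eq_nodal (n : ℕ) :
    T ℝ n = C (2 ^ (n - 1) : ℝ) * Lagrange.nodal
      ((Finset.range n).image (fun (k : ℕ) => cos ((2 * k + 1) * π / (2 * n)))) id := by
  have h := C_leadingCoeff_mul_prod_multiset_X_sub_C (p := T ℝ n) (by
    rw [roots_T_real, Finset.card_val, Finset.card_image_of_injOn, Finset.card_range]
    · simp
    · exact (Finset.range n).nodup_map_iff_injOn.mp (roots_T_real_nodup n))
  rw [← h, roots_T_real]
  simp only [leadingCoeff_T, Int.natAbs_natCast]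
  rfl

/-- Schur's inequality near the endpoint. -/
lemma schur_near {n : ℕ} (hn : n ≠ 0) {r : ℝ[X]} (hr : r.degree < n) {M : ℝ}
    (hM : ∀ θ : ℝ, |sin θ * r.eval (cos θ)| ≤ M) {θ : ℝ} (h0 : 0 ≤ θ) (h1 : θ ≤ π / (2 * n)) :
    |r.eval (cos θ)| ≤ n * M := by
  have hn' : (0 : ℝ) < n := by positivity
  set S := (Finset.range n).image (fun (k : ℕ) => cos ((2 * k + 1) * π / (2 * n))) with hS
  set L : ℝ := 2 ^ (n - 1) with hL
  have hLpos : 0 < L := by positivity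
  have hT : T ℝ n = C L * Lagrange.nodal S id := T_eq_nodal n
  have hcard : S.card = n := by
    rw [hS, Finset.card_image_of_injOn, Finset.card_range]
    exact (Finset.range n).nodup_map_iff_injOn.mp (roots_T_real_nodup n)
  have hM0 : 0 ≤ M := (abs_nonneg _).trans (hM 0)
  have hdT : derivative (T ℝ n) = ∑ i ∈ S, C L * Lagrange.nodal (S.erase i) id := by
    rw [hT, derivative_C_mul, Lagrange.derivative_nodal, Finset.mul_sum]
  -- the interpolation formula
  have hint : r.eval (cos θ) =
      ∑ i ∈ S, r.eval i * ((Lagrange.nodal (S.erase i) id).eval i)⁻¹ *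
        (Lagrange.nodal (S.erase i) id).eval (cos θ) := by
    have h := Lagrange.eq_interpolate (s := S) (v := id) (f := r) (Set.injOn_id _)
      (by rw [hcard]; exact hr)
    conv_lhs => rw [h]
    rw [Lagrange.interpolate_eq_nodalWeight_mul_nodal_div_X_sub_C, eval_finsetSum]
    refine Finset.sum_congr rfl fun i hi => ?_
    rw [← Lagrange.nodal_erase_eq_nodal_div hi, Lagrange.nodalWeight_eq_eval_nodal_erase_inv]
    simp only [eval_mul, eval_C, id]
    ring
  have hw : ∀ i ∈ S, |r.eval i * ((Lagrange.nodal (S.erase i) id).eval i)⁻¹| ≤ M * L / n := by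
    intro i hi
    have e1 : (derivative (T ℝ n)).eval i = L * (Lagrange.nodal (S.erase i) id).eval i := by
      rw [hT, derivative_C_mul, eval_mul, eval_C]
      congr 1
      exact Lagrange.eval_nodal_derivative_eval_node_eq (v := id) hi
    obtain ⟨k, hk, hki⟩ := Finset.mem_image.mp hi
    set φ : ℝ := (2 * k + 1) * π / (2 * n) with hφ
    have e2 := U_real_cos φ ((n : ℤ) - 1)
    have hnφ : (n : ℝ) * φ = k * π + π / 2 := by rw [hφ]; field_simp
    have e3 : |(U ℝ ((n : ℤ) - 1)).eval i * sin φ| = 1 := by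
      rw [← hki, e2]
      push_cast
      rw [sub_add_cancel, hnφ, sin_add_pi_div_two]
      rw [cos_nat_mul_pi, abs_neg_one_pow]
    have e4 : |L * (Lagrange.nodal (S.erase i) id).eval i * sin φ| = n := by
      rw [← e1, T_derivative_eq_U]
      simp only [eval_mul, Int.cast_natCast, eval_natCast]
      rw [mul_assoc, abs_mul, e3]; simp
    have e5 := hM φ
    rw [hki] at e5
    set a := (Lagrange.nodal (S.erase i) id).eval i
    rw [abs_mul, abs_mul, abs_of_pos hLpos] at e4
    rw [abs_mul] at e5
    have ha : 0 < |a| := by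
      rcases (abs_nonneg a).eq_or_lt with h | h
      · rw [← h] at e4; simp at e4; exact absurd e4.symm hn'.ne'
      · exact h
    rw [abs_mul, abs_inv, ← div_eq_mul_inv, div_le_div_iff₀ ha hn', ← e4]
    nlinarith [mul_le_mul_of_nonneg_left e5 (mul_pos hLpos ha).le]
  have hpos : ∀ i ∈ S, 0 ≤ (Lagrange.nodal (S.erase i) id).eval (cos θ) := by
    intro i hi
    rw [Lagrange.eval_nodal]
    refine Finset.prod_nonneg fun j hj => ?_
    obtain ⟨k, hk, hkj⟩ := Finset.mem_image.mp (Finset.mem_of_mem_erase hj)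
    rw [id, ← hkj, sub_nonneg]
    have hk' : (k : ℝ) + 1 ≤ n := by exact_mod_cast Finset.mem_range.mp hk
    apply cos_le_cos_of_nonneg_of_le_pi h0
    · rw [div_le_iff₀ (by positivity)]
      nlinarith [pi_pos]
    · refine h1.trans ?_
      gcongr
      nlinarith [pi_pos, (Nat.cast_nonneg k : (0:ℝ) ≤ k)]
  have hd1 : (derivative (T ℝ n)).eval (cos θ) ≤ (n : ℝ) ^ 2 := by
    have h := abs_iterate_derivative_T_real_le n 1 (abs_cos_le_one θ)
    simp only [Function.iterate_one] at h
    rw [derivative_T_eval_one] at h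
    exact (le_abs_self _).trans (by simpa using h)
  rw [hdT, eval_finsetSum] at hd1
  simp only [eval_mul, eval_C] at hd1
  rw [hint]
  calc _ ≤ ∑ i ∈ S, M * L / n * (Lagrange.nodal (S.erase i) id).eval (cos θ) := by
        refine (Finset.abs_sum_le_sum_abs _ _).trans (Finset.sum_le_sum fun i hi => ?_)
        rw [abs_mul, abs_of_nonneg (hpos i hi)]
        exact mul_le_mul_of_nonneg_right (hw i hi) (hpos i hi)
    _ = M / n * ∑ i ∈ S, L * (Lagrange.nodal (S.erase i) id).eval (cos θ) := by
        rw [Finset.mul_sum]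
        exact Finset.sum_congr rfl fun i _ => by ring
    _ ≤ M / n * (n : ℝ) ^ 2 := by gcongr
    _ = n * M := by field_simp

lemma schur_half {n : ℕ} (hn : n ≠ 0) {r : ℝ[X]} (hr : r.degree < n) {M : ℝ}
    (hM : ∀ θ : ℝ, |sin θ * r.eval (cos θ)| ≤ M) {θ : ℝ} (h0 : 0 ≤ θ) (h1 : θ ≤ π / 2) :
    |r.eval (cos θ)| ≤ n * M := by
  rcases le_total θ (π / (2 * n)) with h | h
  · exact schur_near hn hr hM h0 h
  have hn' : (0 : ℝ) < n := by positivity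
  have hs : 1 / (n : ℝ) ≤ sin θ := by
    refine le_trans ?_ (mul_le_sin h0 h1)
    calc 1 / (n : ℝ) = 2 / π * (π / (2 * n)) := by field_simp
      _ ≤ _ := by gcongr
  have h2 := hM θ
  have h3 : 0 < sin θ := lt_of_lt_of_le (by positivity) hs
  rw [abs_mul, abs_of_pos h3] at h2
  have h4 := mul_le_mul_of_nonneg_right hs (abs_nonneg (r.eval (cos θ)))
  have h5 := h4.trans h2
  rw [div_mul_eq_mul_div, div_le_iff₀ hn'] at h5
  linarith

lemma schur {n : ℕ} (hn : n ≠ 0) {r : ℝ[X]} (hr : r.degree < n) {M : ℝ}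
    (hM : ∀ θ : ℝ, |sin θ * r.eval (cos θ)| ≤ M) {θ : ℝ} (h0 : 0 ≤ θ) (h1 : θ ≤ π) :
    |r.eval (cos θ)| ≤ n * M := by
  rcases le_total θ (π / 2) with h | h
  · exact schur_half hn hr hM h0 h
  have hr' : (r.comp (-X)).degree < n := by
    rwa [degree_comp_neg_X]
  have := schur_half hn hr' (M := M) (fun φ => by
    have := hM (π - φ)
    simpa [cos_pi_sub, sin_pi_sub] using this) (θ := π - θ) (by linarith) (by linarith)
  simpa [cos_pi_sub] using this

lemma addition (c s : ℝ) : ∀ (n : ℕ) (p : ℝ[X]), p.natDegree ≤ n →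
    ∃ A B : ℝ[X], A.degree ≤ n ∧ B.degree < n ∧ ∀ θ : ℝ,
      p.eval (cos θ * c - sin θ * s) = A.eval (cos θ) + sin θ * B.eval (cos θ) := by
  intro n
  induction n with
  | zero =>
    intro p hp
    refine ⟨C (p.coeff 0), 0, degree_C_le, by simp, fun θ => ?_⟩
    rw [eq_C_of_natDegree_le_zero hp]; simp
  | succ n ih =>
    intro p hp
    obtain ⟨A, B, hA, hB, h⟩ := ih p.divX (by rw [natDegree_divX_eq_natDegree_tsub_one]; omega)
    have hB' : B ∈ degreeLT ℝ n := mem_degreeLT.mpr hB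
    have hdc : ∀ (a : ℝ) (Q : ℝ[X]), (C a * Q).degree ≤ Q.degree := fun a Q => by
      rw [← smul_eq_C_mul]; exact degree_smul_le a Q
    have hXA : (A * X).degree ≤ ((n + 1 : ℕ) : WithBot ℕ) := by
      rw [degree_mul_X]; push_cast; gcongr
    have hXB : (B * X).degree < ((n + 1 : ℕ) : WithBot ℕ) := by
      by_cases h : B = 0
      · subst h; rw [zero_mul, degree_zero]; exact WithBot.bot_lt_coe _
      rw [degree_mul_X, degree_eq_natDegree h]
      rw [degree_eq_natDegree h] at hB
      have : B.natDegree < n := by exact_mod_cast hB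
      exact_mod_cast (by omega : B.natDegree + 1 < n + 1)
    have hQB : (B * (1 - X ^ 2)).degree ≤ ((n + 1 : ℕ) : WithBot ℕ) := by
      by_cases h : B = 0
      · subst h; rw [zero_mul, degree_zero]; exact bot_le
      have hb : B.natDegree < n := by
        rw [degree_eq_natDegree h] at hB
        exact_mod_cast hB
      apply degree_le_of_natDegree_le
      refine natDegree_mul_le.trans ?_
      have : (1 - X ^ 2 : ℝ[X]).natDegree ≤ 2 := by compute_degree
      omega
    have hAlt : A.degree < ((n + 1 : ℕ) : WithBot ℕ) :=
      lt_of_le_of_lt hA (by exact_mod_cast Nat.lt_succ_self n)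
    refine ⟨C c * (A * X) - C s * (B * (1 - X ^ 2)) + C (p.coeff 0),
      C c * (B * X) - C s * A, ?_, ?_, fun θ => ?_⟩
    · refine (degree_add_le _ _).trans (max_le ((degree_sub_le _ _).trans (max_le ?_ ?_)) ?_)
      · exact (hdc _ _).trans hXA
      · exact (hdc _ _).trans hQB
      · exact degree_C_le.trans (by exact_mod_cast Nat.zero_le _)
    · refine (degree_sub_le _ _).trans_lt (max_lt ?_ ?_)
      · exact (hdc _ _).trans_lt hXB
      · exact (hdc _ _).trans_lt hAlt
    · conv_lhs => rw [← divX_mul_X_add p]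
      simp only [eval_add, eval_mul, eval_X, eval_C, eval_sub, eval_one, eval_pow]
      rw [h θ]
      have := sin_sq_add_cos_sq θ
      have e : 1 - cos θ ^ 2 = sin θ ^ 2 := by linarith
      rw [e]; ring

lemma bernstein {n : ℕ} (hn : n ≠ 0) {p : ℝ[X]} (hp : p.natDegree ≤ n) {M : ℝ}
    (hM : ∀ x : ℝ, |x| ≤ 1 → |p.eval x| ≤ M) (α : ℝ) :
    |sin α * (derivative p).eval (cos α)| ≤ n * M := by
  obtain ⟨A, B, hA, hB, h⟩ := addition (cos α) (sin α) n p hp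
  have hB1 : |B.eval (cos 0)| ≤ n * M := by
    refine schur hn hB (fun θ => ?_) le_rfl pi_pos.le
    have h1 := h θ
    have h2 := h (-θ)
    rw [← cos_add] at h1
    rw [← cos_add, cos_neg, sin_neg] at h2
    have m1 := abs_le.mp (hM _ (abs_cos_le_one (θ + α)))
    have m2 := abs_le.mp (hM _ (abs_cos_le_one (-θ + α)))
    rw [abs_le]
    constructor <;> linarith
  have d1 : HasDerivAt (fun θ : ℝ => p.eval (cos (θ + α)))
      ((derivative p).eval (cos (0 + α)) * (-sin (0 + α) * 1)) 0 := by
    have := ((hasDerivAt_id (0:ℝ)).add_const α).cos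
    exact (p.hasDerivAt _).comp (0:ℝ) this
  have d2 : HasDerivAt (fun θ : ℝ => A.eval (cos θ) + sin θ * B.eval (cos θ))
      ((derivative A).eval (cos 0) * (-sin 0) +
        (cos 0 * B.eval (cos 0) + sin 0 * ((derivative B).eval (cos 0) * (-sin 0)))) 0 := by
    have hA' := (A.hasDerivAt (cos 0)).comp (0:ℝ) (hasDerivAt_cos 0)
    have hB' := (B.hasDerivAt (cos 0)).comp (0:ℝ) (hasDerivAt_cos 0)
    exact hA'.add ((hasDerivAt_sin 0).mul hB')
  have hfun : (fun θ : ℝ => p.eval (cos (θ + α))) =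
      (fun θ : ℝ => A.eval (cos θ) + sin θ * B.eval (cos θ)) := by
    funext θ; rw [cos_add]; exact h θ
  rw [hfun] at d1
  have := d1.unique d2
  simp only [sin_zero, zero_add, neg_zero, mul_zero, zero_mul, add_zero, mul_one] at this
  have e : sin α * (derivative p).eval (cos α) = -B.eval (cos 0) := by
    rw [cos_zero] at this ⊢
    linarith
  rw [e, abs_neg]
  exact hB1

/-- Markov brothers' inequality. -/
lemma markov {n : ℕ} {p : ℝ[X]} (hp : p.natDegree ≤ n) {M : ℝ}
    (hM : ∀ x : ℝ, |x| ≤ 1 → |p.eval x| ≤ M) {x : ℝ} (hx : |x| ≤ 1) :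
    |(derivative p).eval x| ≤ (n : ℝ) ^ 2 * M := by
  rcases eq_or_ne n 0 with rfl | hn
  · rw [eq_C_of_natDegree_le_zero hp]; simp
  obtain ⟨hx1, hx2⟩ := abs_le.mp hx
  have hd : (derivative p).degree < n := by
    by_cases h : derivative p = 0
    · rw [h, degree_zero]; exact WithBot.bot_lt_coe _
    rw [degree_eq_natDegree h]
    have := natDegree_derivative_le p
    exact_mod_cast (by omega : (derivative p).natDegree < n)
  have := schur hn hd (bernstein hn hp hM) (arccos_nonneg x) (arccos_le_pi x)
  rw [cos_arccos hx1 hx2] at this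
  linarith [this, (by ring : (n:ℝ) * (n * M) = (n : ℝ) ^ 2 * M)]

end MarkovAux

/-- Theorem of Ehlich–Zeller and Rivlin–Cheney: if a real polynomial `p` is
bounded between `b₁` and `b₂` on the integers `0, 1, …, N` and its derivative
has absolute value at least `c > 0` at some real point of `[0, N]`, then
`(deg p)² ≥ c·N/(c + b₂ − b₁)`. -/
theorem ehlich_zeller_rivlin_cheney (p : Polynomial ℝ) (N : ℕ) (hN : 0 < N)
    (b₁ b₂ : ℝ) (hb : b₁ ≤ b₂) (c : ℝ) (hc : 0 < c)
    (hbound : ∀ i : ℕ, i ≤ N → b₁ ≤ p.eval (i : ℝ) ∧ p.eval (i : ℝ) ≤ b₂)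
    (hderiv : ∃ x : ℝ, 0 ≤ x ∧ x ≤ (N : ℝ) ∧ c ≤ |(Polynomial.derivative p).eval x|) :
    c * N / (c + b₂ - b₁) ≤ (p.natDegree : ℝ) ^ 2 := by
  have hN' : (0 : ℝ) < N := by exact_mod_cast hN
  obtain ⟨x, hx0, hxN, hxc⟩ := hderiv
  obtain ⟨z, hz, hmax⟩ := (isCompact_Icc (a := (0:ℝ)) (b := N)).exists_isMaxOn
    ⟨x, hx0, hxN⟩ ((derivative p).continuous.abs.continuousOn)
  set c' := |(derivative p).eval z| with hc'
  have hle : ∀ y ∈ Set.Icc (0:ℝ) N, |(derivative p).eval y| ≤ c' := fun y hy => hmax hy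
  have hcc' : c ≤ c' := hxc.trans (hle x ⟨hx0, hxN⟩)
  have hrange : ∀ y ∈ Set.Icc (0:ℝ) N, b₁ - c' / 2 ≤ p.eval y ∧ p.eval y ≤ b₂ + c' / 2 := by
    intro y hy
    obtain ⟨i, hiN, hi⟩ : ∃ i : ℕ, i ≤ N ∧ |y - i| ≤ 1 / 2 := by
      have h1 := Nat.floor_le hy.1
      have h2 := Nat.lt_floor_add_one y
      rcases le_total (y - ⌊y⌋₊) (1 / 2) with h | h
      · refine ⟨⌊y⌋₊, ?_, ?_⟩
        · exact_mod_cast h1.trans hy.2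
        · rw [abs_le]; constructor <;> linarith
      · refine ⟨⌊y⌋₊ + 1, ?_, ?_⟩
        · have : (⌊y⌋₊ : ℝ) < N := by linarith [hy.2]
          exact_mod_cast this
        · push_cast; rw [abs_le]; constructor <;> linarith
    have hiI : (i : ℝ) ∈ Set.Icc (0:ℝ) N := ⟨by positivity, by exact_mod_cast hiN⟩
    have hmv := (convex_Icc (0:ℝ) N).norm_image_sub_le_of_norm_deriv_le (f := fun t => p.eval t)
      (C := c') (fun t _ => p.differentiableAt) (fun t ht => by
        rw [Polynomial.deriv]; exact hle t ht) hiI hy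
    simp only [Real.norm_eq_abs] at hmv
    have h3 : c' * |y - i| ≤ c' * (1 / 2) := mul_le_mul_of_nonneg_left hi (by linarith)
    have h4 := abs_le.mp (hmv.trans h3)
    have h5 := hbound i hiN
    constructor <;> linarith [h4.1, h4.2, h5.1, h5.2]
  set q : ℝ[X] := p.comp (C (N / 2 : ℝ) * X + C (N / 2 : ℝ)) - C ((b₁ + b₂) / 2) with hq
  have hqd : q.natDegree ≤ p.natDegree := by
    rw [hq, natDegree_sub_C, natDegree_comp]
    have : (C (N / 2 : ℝ) * X + C (N / 2 : ℝ)).natDegree ≤ 1 := natDegree_linear_le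
    nlinarith
  have hqM : ∀ t : ℝ, |t| ≤ 1 → |q.eval t| ≤ (b₂ - b₁ + c') / 2 := by
    intro t ht
    obtain ⟨t1, t2⟩ := abs_le.mp ht
    have := hrange (N / 2 * t + N / 2) ⟨by nlinarith, by nlinarith⟩
    simp only [hq, eval_sub, eval_comp, eval_add, eval_mul, eval_C, eval_X]
    rw [abs_le]
    constructor <;> linarith [this.1, this.2]
  have hmk := MarkovAux.markov hqd hqM (x := 2 * z / N - 1) (by
    have h1 : 0 ≤ 2 * z / N := div_nonneg (by linarith [hz.1]) hN'.le
    have h2 : 2 * z / N ≤ 2 := by rw [div_le_iff₀ hN']; linarith [hz.2]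
    rw [abs_le]; constructor <;> linarith)
  have hev : (derivative q).eval (2 * z / N - 1) = N / 2 * (derivative p).eval z := by
    have e : (N : ℝ) / 2 * (2 * z / N - 1) + N / 2 = z := by field_simp; ring
    simp [hq, derivative_comp, e]
  rw [hev, abs_mul, abs_of_pos (by positivity : (0:ℝ) < N / 2), ← hc'] at hmk
  have hden : 0 < c + b₂ - b₁ := by linarith
  have hden' : 0 < c' + b₂ - b₁ := by linarith
  have hfin : c' * N / (c' + b₂ - b₁) ≤ (p.natDegree : ℝ) ^ 2 := by
    rw [div_le_iff₀ hden']; linarith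
  refine le_trans ?_ hfin
  rw [div_le_div_iff₀ hden hden']
  nlinarith [mul_nonneg (mul_nonneg (sub_nonneg.mpr hcc') (sub_nonneg.mpr hb)) hN'.le]
end
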